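/- arXiv:2409.15761 — 6 statements merged into one kernel-verified Lean document; each statement's English description precedes it below -/
import Mathlib

section
/- (Tweedie's formula.) The function log p is differentiable on ℝⁿ and for every y ∈ ℝⁿ, ∇ log p(y) = (√ᾱ·m(y) − y)/(1 − ᾱ); equivalently, the posterior mean satisfies m(y) = (y + (1 − ᾱ)·∇ log p(y))/√ᾱ. -/
open MeasureTheory

section GaussianSmoothing

variable {E : Type*} [NormedAddCommGroup E] [InnerProductSpace ℝ E]

/-- The Gaussian bump `C · exp(−‖y − a x‖² / (2 s))`. -/
noncomputable def gaussianBump (C a s : ℝ) (y x : E) : ℝ :=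
  C * Real.exp (-‖y - a • x‖ ^ 2 / (2 * s))

lemma gaussianBump_pos {C : ℝ} (hC : 0 < C) (a s : ℝ) (y x : E) : 0 < gaussianBump C a s y x :=
  mul_pos hC (Real.exp_pos _)

lemma continuous_gaussianBump (C a s : ℝ) (y : E) : Continuous (gaussianBump C a s y) := by
  unfold gaussianBump
  fun_prop

lemma gaussianBump_le {C s : ℝ} (hC : 0 < C) (hs : 0 < s) (a : ℝ) (y x : E) :
    gaussianBump C a s y x ≤ C := by
  refine mul_le_of_le_one_right hC.le (Real.exp_le_one_iff.2 ?_)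
  rw [neg_div]
  exact neg_nonpos.2 (by positivity)

lemma mul_exp_neg_sq_div_le {s : ℝ} (hs : 0 < s) (r : ℝ) :
    r * Real.exp (-r ^ 2 / (2 * s)) ≤ 1 + s := by
  rw [neg_div, Real.exp_neg, ← div_eq_mul_inv, div_le_iff₀ (Real.exp_pos _)]
  have h : r ^ 2 / (2 * s) + 1 ≤ Real.exp (r ^ 2 / (2 * s)) := Real.add_one_le_exp _
  have h' : r ≤ (1 + s) * (r ^ 2 / (2 * s) + 1) := by
    have e : (1 + s) * (r ^ 2 / (2 * s) + 1) = r ^ 2 / (2 * s) + r ^ 2 / 2 + 1 + s := by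
      field_simp
      ring
    have : 0 ≤ r ^ 2 / (2 * s) := by positivity
    nlinarith [sq_nonneg (r - 1)]
  exact h'.trans (by gcongr)

lemma hasGradientAt_gaussianBump [CompleteSpace E] (C a s : ℝ) (y x : E) :
    HasGradientAt (fun z => gaussianBump C a s z x)
      ((-(gaussianBump C a s y x / s)) • (y - a • x)) y := by
  rw [hasGradientAt_iff_hasFDerivAt]
  have h : HasFDerivAt (fun z : E => ‖z - a • x‖ ^ 2) _ y :=
    ((hasFDerivAt_id y).sub_const (a • x)).norm_sq
  have h2 := ((h.neg.mul_const (2 * s)⁻¹).exp).const_mul C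
  simp only [← div_eq_mul_inv] at h2
  refine h2.congr_fderiv ?_
  ext v
  simp [gaussianBump]
  ring

lemma norm_gradient_gaussianBump_le {C s : ℝ} (hC : 0 < C) (hs : 0 < s) (a : ℝ) (y x : E) :
    ‖(-(gaussianBump C a s y x / s)) • (y - a • x)‖ ≤ C / s * (1 + s) := by
  rw [norm_smul, norm_neg, Real.norm_of_nonneg (div_pos (gaussianBump_pos hC a s y x) hs).le]
  calc gaussianBump C a s y x / s * ‖y - a • x‖
      = C / s * (‖y - a • x‖ * Real.exp (-‖y - a • x‖ ^ 2 / (2 * s))) := by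
        unfold gaussianBump
        ring
    _ ≤ C / s * (1 + s) := by
        gcongr
        exact mul_exp_neg_sq_div_le hs _

variable [MeasurableSpace E] [BorelSpace E] {μ : Measure E}

lemma integral_id_withDensity_gaussianBump {C : ℝ} (hC : 0 < C) (a s : ℝ) (y : E) {c : ℝ}
    (hc : 0 < c) :
    ∫ x, x ∂(μ.withDensity fun x => ENNReal.ofReal (gaussianBump C a s y x / c)) =
      c⁻¹ • ∫ x, gaussianBump C a s y x • x ∂μ := by
  have hcont := continuous_gaussianBump C a s y
  rw [integral_withDensity_eq_integral_toReal_smul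
    (hcont.div_const c).measurable.ennreal_ofReal
    (.of_forall fun x => ENNReal.ofReal_lt_top), ← integral_smul]
  refine integral_congr_ae (.of_forall fun x => ?_)
  simp only
  rw [ENNReal.toReal_ofReal (div_pos (gaussianBump_pos hC a s y x) hc).le, smul_smul,
    div_eq_inv_mul]

variable [IsProbabilityMeasure μ]

lemma integrable_gaussianBump {C s : ℝ} (hC : 0 < C) (hs : 0 < s) (a : ℝ) (y : E) :
    Integrable (gaussianBump C a s y) μ :=
  Integrable.of_bound (continuous_gaussianBump C a s y).aestronglyMeasurable C
    (.of_forall fun x => by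
      rw [Real.norm_of_nonneg (gaussianBump_pos hC a s y x).le]
      exact gaussianBump_le hC hs a y x)

lemma integral_gaussianBump_pos {C s : ℝ} (hC : 0 < C) (hs : 0 < s) (a : ℝ) (y : E) :
    0 < ∫ x, gaussianBump C a s y x ∂μ := by
  refine (integral_pos_iff_support_of_nonneg (fun x => (gaussianBump_pos hC a s y x).le)
    (integrable_gaussianBump hC hs a y)).2 ?_
  have : Function.support (gaussianBump C a s y) = Set.univ :=
    Set.eq_univ_of_forall fun x => (gaussianBump_pos hC a s y x).ne'
  simp [this]

variable [SecondCountableTopology E]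

lemma integrable_gradient_gaussianBump {C s : ℝ} (hC : 0 < C) (hs : 0 < s) (a : ℝ) (y : E) :
    Integrable (fun x => (-(gaussianBump C a s y x / s)) • (y - a • x)) μ := by
  have := continuous_gaussianBump C a s y
  exact Integrable.of_bound (by fun_prop : Continuous _).aestronglyMeasurable _
    (.of_forall (norm_gradient_gaussianBump_le hC hs a y))

lemma hasGradientAt_integral_gaussianBump [CompleteSpace E] {C s : ℝ} (hC : 0 < C) (hs : 0 < s)
    (a : ℝ) (y : E) :
    HasGradientAt (fun z => ∫ x, gaussianBump C a s z x ∂μ)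
      (∫ x, (-(gaussianBump C a s y x / s)) • (y - a • x) ∂μ) y := by
  have hint := integrable_gradient_gaussianBump (μ := μ) hC hs a y
  rw [hasGradientAt_iff_hasFDerivAt]
  have key := hasFDerivAt_integral_of_dominated_of_fderiv_le (μ := μ) (s := Set.univ)
    (F := gaussianBump C a s) (bound := fun _ => C / s * (1 + s))
    (F' := fun y x => InnerProductSpace.toDual ℝ E ((-(gaussianBump C a s y x / s)) • (y - a • x)))
    (x₀ := y) Filter.univ_mem
    (.of_forall fun z => (continuous_gaussianBump C a s z).aestronglyMeasurable)
    (integrable_gaussianBump hC hs a y)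
    ((InnerProductSpace.toDual ℝ E).continuous.comp_aestronglyMeasurable hint.1)
    (.of_forall fun x z _ => by
      rw [LinearIsometryEquiv.norm_map]
      exact norm_gradient_gaussianBump_le hC hs a z x)
    (integrable_const _)
    (.of_forall fun x z _ => hasGradientAt_iff_hasFDerivAt.1 (hasGradientAt_gaussianBump C a s z x))
  refine key.congr_fderiv ?_
  ext v
  rw [ContinuousLinearMap.integral_apply
    (hint.norm.mono' ((InnerProductSpace.toDual ℝ E).continuous.comp_aestronglyMeasurable hint.1)
      (.of_forall fun x => (LinearIsometryEquiv.norm_map _ _).le))]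
  simp only [InnerProductSpace.toDual_apply_apply]
  rw [real_inner_comm, ← integral_inner hint]
  exact integral_congr_ae (.of_forall fun x => real_inner_comm _ _)

lemma integrable_gaussianBump_smul_id {C a s : ℝ} (hC : 0 < C) (ha : a ≠ 0) (hs : 0 < s) (y : E) :
    Integrable (fun x => gaussianBump C a s y x • x) μ := by
  refine ((((integrable_gaussianBump hC hs a y).smul_const y).add
    ((integrable_gradient_gaussianBump hC hs a y).smul s)).smul a⁻¹).congr (.of_forall fun x => ?_)
  simp only [Pi.smul_apply, Pi.add_apply]
  match_scalars
  · field_simp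
    ring
  · field_simp

lemma integral_gradient_gaussianBump [CompleteSpace E] {C a s : ℝ} (hC : 0 < C) (ha : a ≠ 0)
    (hs : 0 < s) (y : E) :
    ∫ x, (-(gaussianBump C a s y x / s)) • (y - a • x) ∂μ =
      s⁻¹ • (a • ∫ x, gaussianBump C a s y x • x ∂μ - (∫ x, gaussianBump C a s y x ∂μ) • y) := by
  rw [← integral_smul, ← integral_smul_const, ← integral_sub, ← integral_smul]
  · refine integral_congr_ae (.of_forall fun x => ?_)
    simp only
    module
  · exact (integrable_gaussianBump_smul_id hC ha hs y).smul a
  · exact (integrable_gaussianBump hC hs a y).smul_const y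

lemma hasGradientAt_log_integral_gaussianBump [CompleteSpace E] {C a s : ℝ} (hC : 0 < C)
    (ha : a ≠ 0) (hs : 0 < s) (y : E) :
    HasGradientAt (fun z => Real.log (∫ x, gaussianBump C a s z x ∂μ))
      (s⁻¹ • (a • ((∫ x, gaussianBump C a s y x ∂μ)⁻¹ • ∫ x, gaussianBump C a s y x • x ∂μ) - y))
      y := by
  have hpos := integral_gaussianBump_pos (μ := μ) hC hs a y
  have h := (hasGradientAt_iff_hasFDerivAt.1
    (hasGradientAt_integral_gaussianBump (μ := μ) hC hs a y)).log hpos.ne'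
  rw [hasGradientAt_iff_hasFDerivAt]
  refine h.congr_fderiv ?_
  rw [integral_gradient_gaussianBump hC ha hs]
  ext v
  simp only [smul_apply, InnerProductSpace.toDual_apply_apply, smul_eq_mul]
  rw [← real_inner_smul_left]
  congr 1
  match_scalars <;> field_simp

end GaussianSmoothing

/-- Tweedie's formula: `∇ log p(y) = (√ᾱ·m(y) − y)/(1 − ᾱ)`. -/
theorem stmt_1 (n : ℕ) (hn : 1 ≤ n) (α : ℝ) (hα0 : 0 < α) (hα1 : α < 1)
    (μ : Measure (EuclideanSpace ℝ (Fin n))) [IsProbabilityMeasure μ]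
    (φ : EuclideanSpace ℝ (Fin n) → EuclideanSpace ℝ (Fin n) → ℝ)
    (hφ : ∀ y x, φ y x = (2 * Real.pi * (1 - α)) ^ (-(n : ℝ) / 2) *
        Real.exp (-‖y - Real.sqrt α • x‖ ^ 2 / (2 * (1 - α))))
    (p : EuclideanSpace ℝ (Fin n) → ℝ)
    (hp : ∀ y, p y = ∫ x, φ y x ∂μ)
    (ν : EuclideanSpace ℝ (Fin n) → Measure (EuclideanSpace ℝ (Fin n)))
    (hν : ∀ y, ν y = μ.withDensity fun x => ENNReal.ofReal (φ y x / p y))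
    (m : EuclideanSpace ℝ (Fin n) → EuclideanSpace ℝ (Fin n))
    (hm : ∀ y, m y = ∫ x, x ∂(ν y)) :
    Differentiable ℝ (fun y => Real.log (p y)) ∧
    (∀ y, gradient (fun z => Real.log (p z)) y = (1 - α)⁻¹ • (Real.sqrt α • m y - y)) ∧
    (∀ y, m y = (Real.sqrt α)⁻¹ • (y + (1 - α) • gradient (fun z => Real.log (p z)) y)) := by
  have hs : 0 < 1 - α := sub_pos.2 hα1
  have ha : Real.sqrt α ≠ 0 := (Real.sqrt_pos.2 hα0).ne'
  set C : ℝ := (2 * Real.pi * (1 - α)) ^ (-(n : ℝ) / 2)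
  have hC : 0 < C := Real.rpow_pos_of_pos (by positivity) _
  obtain rfl : φ = gaussianBump C (Real.sqrt α) (1 - α) := funext₂ hφ
  obtain rfl := funext hp
  have hgrad : ∀ y, HasGradientAt
      (fun z => Real.log (∫ x, gaussianBump C (Real.sqrt α) (1 - α) z x ∂μ))
      ((1 - α)⁻¹ • (Real.sqrt α • m y - y)) y := fun y => by
    rw [hm, hν, integral_id_withDensity_gaussianBump hC _ _ y
      (integral_gaussianBump_pos hC hs _ y)]
    exact hasGradientAt_log_integral_gaussianBump hC ha hs y
  refine ⟨fun y => (hgrad y).differentiableAt, fun y => (hgrad y).gradient, fun y => ?_⟩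
  rw [(hgrad y).gradient, smul_inv_smul₀ hs.ne', add_sub_cancel, inv_smul_smul₀ ha]
end

section
/- (Hessian–covariance identity, core of Lemma 1.) The function log p is twice differentiable on ℝⁿ and for every y ∈ ℝⁿ its Hessian satisfies ∇² log p(y) = −(1/(1 − ᾱ))·I + (ᾱ/(1 − ᾱ)²)·Σ(y), where I is the identity operator on ℝⁿ; equivalently, as a bilinear form, (∇² log p(y))(u,v) = −⟨u,v⟩/(1 − ᾱ) + (ᾱ/(1 − ᾱ)²)·⟨Σ(y)u, v⟩ for all u, v ∈ ℝⁿ. -/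
open MeasureTheory
open scoped RealInnerProductSpace

open ProbabilityTheory

section General

variable {E F : Type*} [NormedAddCommGroup E] [NormedSpace ℝ E] [NormedAddCommGroup F]

section Integral

variable [MeasurableSpace E] [BorelSpace E] [SecondCountableTopology E]

/-- A bounded continuous profile is integrable along an affine reparametrization. -/
lemma integrable_comp_sub_smul (μ : Measure E) [IsFiniteMeasure μ] {g : E → F}
    (hg : Continuous g) {C : ℝ} (hC : ∀ z, ‖g z‖ ≤ C) (s : ℝ) (y : E) :
    Integrable (fun x => g (y - s • x)) μ :=
  (integrable_const C).mono' (by fun_prop) (Filter.Eventually.of_forall fun _ => hC _)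

variable [NormedSpace ℝ F]

lemma continuous_integral_comp_sub_smul (μ : Measure E) [IsFiniteMeasure μ] {g : E → F}
    (hg : Continuous g) {C : ℝ} (hC : ∀ z, ‖g z‖ ≤ C) (s : ℝ) :
    Continuous fun y => ∫ x, g (y - s • x) ∂μ :=
  continuous_of_dominated (fun _ => by fun_prop)
    (fun _ => Filter.Eventually.of_forall fun _ => hC _) (integrable_const C)
    (Filter.Eventually.of_forall fun _ => by fun_prop)

lemma hasFDerivAt_integral_comp_sub_smul (μ : Measure E) [IsFiniteMeasure μ] {g : E → F}
    {g' : E → E →L[ℝ] F} (hg : ∀ z, HasFDerivAt g (g' z) z) (hg' : Continuous g') {C C' : ℝ}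
    (hC : ∀ z, ‖g z‖ ≤ C) (hC' : ∀ z, ‖g' z‖ ≤ C') (s : ℝ) (y : E) :
    HasFDerivAt (fun y => ∫ x, g (y - s • x) ∂μ) (∫ x, g' (y - s • x) ∂μ) y := by
  have hgc : Continuous g := continuous_iff_continuousAt.2 fun z => (hg z).continuousAt
  refine hasFDerivAt_integral_of_dominated_of_fderiv_le
    (F' := fun y x => g' (y - s • x)) Filter.univ_mem
    (Filter.Eventually.of_forall fun _ => by fun_prop)
    (integrable_comp_sub_smul μ hgc hC s y) (by fun_prop)
    (Filter.Eventually.of_forall fun _ _ _ => hC' _) (integrable_const C')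
    (Filter.Eventually.of_forall fun x z _ => ?_)
  exact (hg (z - s • x)).comp z ((hasFDerivAt_id z).sub_const (s • x))

end Integral

lemma hasFDerivAt_inv_smul_fderiv {p : E → ℝ} {p' : E → E →L[ℝ] ℝ} {p'' : E →L[ℝ] E →L[ℝ] ℝ}
    {y : E} (hp : HasFDerivAt p (p' y) y) (hp' : HasFDerivAt p' p'' y) (h0 : p y ≠ 0) :
    HasFDerivAt (fun z => (p z)⁻¹ • p' z)
      ((p y)⁻¹ • p'' + (-(p y ^ 2)⁻¹ • p' y).smulRight (p' y)) y :=
  ((hasDerivAt_inv h0).comp_hasFDerivAt y hp).fun_smul hp'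

lemma contDiff_two_log {p : E → ℝ} {p' : E → E →L[ℝ] ℝ} {p'' : E → E →L[ℝ] E →L[ℝ] ℝ}
    (hp : ∀ y, HasFDerivAt p (p' y) y) (hp' : ∀ y, HasFDerivAt p' (p'' y) y)
    (hc : Continuous p'') (h0 : ∀ y, p y ≠ 0) :
    ContDiff ℝ 2 fun z => Real.log (p z) := by
  have h1 : ContDiff ℝ 1 p' := contDiff_one_iff_hasFDerivAt.2 ⟨p'', hc, hp'⟩
  have h2 : ContDiff ℝ ((1 : ℕ) + 1) p := contDiff_succ_iff_hasFDerivAt.2 ⟨p', h1, hp⟩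
  exact ContDiff.log (by simpa [one_add_one_eq_two] using h2) h0

lemma iteratedFDeriv_two_log {p : E → ℝ} {p' : E → E →L[ℝ] ℝ} {p'' : E → E →L[ℝ] E →L[ℝ] ℝ}
    (hp : ∀ y, HasFDerivAt p (p' y) y) (hp' : ∀ y, HasFDerivAt p' (p'' y) y)
    (h0 : ∀ y, p y ≠ 0) (y u v : E) :
    iteratedFDeriv ℝ 2 (fun z => Real.log (p z)) y ![u, v]
      = p'' y u v / p y - (p' y u / p y) * (p' y v / p y) := by
  have h : fderiv ℝ (fun z => Real.log (p z)) = fun z => (p z)⁻¹ • p' z :=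
    funext fun z => ((hp z).log (h0 z)).fderiv
  rw [iteratedFDeriv_two_apply, h, (hasFDerivAt_inv_smul_fderiv (hp y) (hp' y) (h0 y)).fderiv]
  have := h0 y
  simp
  field_simp
  ring

end General

section GaussianProfile

variable {E : Type*} [NormedAddCommGroup E]

/-- The centred Gaussian profile with prefactor `A` and variance `c`. -/
noncomputable def gaussianProfile (A c : ℝ) (z : E) : ℝ :=
  A * Real.exp (-‖z‖ ^ 2 / (2 * c))

@[fun_prop]
lemma continuous_gaussianProfile (A c : ℝ) : Continuous (gaussianProfile A c : E → ℝ) := by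
  unfold gaussianProfile; fun_prop

lemma gaussianProfile_pos {A : ℝ} (hA : 0 < A) (c : ℝ) (z : E) : 0 < gaussianProfile A c z := by
  unfold gaussianProfile; positivity

lemma gaussianProfile_le {A c : ℝ} (hA : 0 < A) (hc : 0 < c) (z : E) :
    gaussianProfile A c z ≤ A := by
  refine mul_le_of_le_one_right hA.le (Real.exp_le_one_iff.2 ?_)
  rw [neg_div]
  exact neg_nonpos.2 (by positivity)

lemma norm_sq_mul_gaussianProfile_le {A c : ℝ} (hA : 0 < A) (hc : 0 < c) (z : E) :
    ‖z‖ ^ 2 * gaussianProfile A c z ≤ 2 * c * A := by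
  have h : ‖z‖ ^ 2 / (2 * c) ≤ Real.exp (‖z‖ ^ 2 / (2 * c)) := by
    linarith [Real.add_one_le_exp (‖z‖ ^ 2 / (2 * c))]
  rw [gaussianProfile, neg_div, Real.exp_neg]
  rw [div_le_iff₀ (by positivity)] at h
  calc ‖z‖ ^ 2 * (A * (Real.exp (‖z‖ ^ 2 / (2 * c)))⁻¹)
      ≤ (Real.exp (‖z‖ ^ 2 / (2 * c)) * (2 * c)) * (A * (Real.exp (‖z‖ ^ 2 / (2 * c)))⁻¹) := by
        gcongr
    _ = 2 * c * A := by field_simp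

lemma norm_gaussianProfile_le {A c : ℝ} (hA : 0 < A) (hc : 0 < c) (z : E) :
    ‖gaussianProfile A c z‖ ≤ A := by
  rw [Real.norm_of_nonneg (gaussianProfile_pos hA c z).le]
  exact gaussianProfile_le hA hc z

section InnerProductSpace

variable [InnerProductSpace ℝ E]

variable (E) in
/-- The real inner product as a continuous bilinear map. -/
noncomputable def realInnerSL : E →L[ℝ] E →L[ℝ] ℝ := innerSL ℝ

@[simp]
lemma realInnerSL_apply (u v : E) : realInnerSL E u v = ⟪u, v⟫ := rfl

/-- The derivative of `gaussianProfile`. -/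
noncomputable def gaussianProfileDeriv (A c : ℝ) (z : E) : E →L[ℝ] ℝ :=
  (-c⁻¹ * gaussianProfile A c z) • realInnerSL E z

/-- The second derivative of `gaussianProfile`. -/
noncomputable def gaussianProfileDeriv₂ (A c : ℝ) (z : E) : E →L[ℝ] E →L[ℝ] ℝ :=
  (-c⁻¹ * gaussianProfile A c z) • realInnerSL E +
    (-c⁻¹ • gaussianProfileDeriv A c z).smulRight (realInnerSL E z)

@[fun_prop]
lemma continuous_gaussianProfileDeriv (A c : ℝ) :
    Continuous (gaussianProfileDeriv A c : E → E →L[ℝ] ℝ) := by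
  unfold gaussianProfileDeriv; fun_prop

lemma continuous_gaussianProfileDeriv₂ (A c : ℝ) :
    Continuous (gaussianProfileDeriv₂ A c : E → E →L[ℝ] E →L[ℝ] ℝ) := by
  have : Continuous fun z : E =>
      ContinuousLinearMap.smulRightL ℝ E (E →L[ℝ] ℝ) (-c⁻¹ • gaussianProfileDeriv A c z)
        (realInnerSL E z) := by fun_prop
  unfold gaussianProfileDeriv₂
  exact Continuous.add (by fun_prop) this

lemma hasFDerivAt_gaussianProfile (A c : ℝ) (z : E) :
    HasFDerivAt (gaussianProfile A c) (gaussianProfileDeriv A c z) z := by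
  have h := (((((hasFDerivAt_id z).norm_sq).const_mul (-(2 * c)⁻¹)).exp).const_mul A)
  refine (h.congr_fderiv ?_).congr_of_eventuallyEq (Filter.Eventually.of_forall fun w => ?_)
  · ext w
    simp [gaussianProfileDeriv, gaussianProfile, div_eq_inv_mul]
    ring
  · simp [gaussianProfile, div_eq_inv_mul]

lemma hasFDerivAt_gaussianProfileDeriv (A c : ℝ) (z : E) :
    HasFDerivAt (gaussianProfileDeriv A c) (gaussianProfileDeriv₂ A c z) z :=
  ((hasFDerivAt_gaussianProfile A c z).const_mul (-c⁻¹)).fun_smul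
    (realInnerSL E).hasFDerivAt

lemma norm_gaussianProfileDeriv_le {A c : ℝ} (hA : 0 < A) (hc : 0 < c) (z : E) :
    ‖gaussianProfileDeriv A c z‖ ≤ c⁻¹ * (A + 2 * c * A) := by
  have h := gaussianProfile_pos hA c z
  rw [gaussianProfileDeriv, norm_smul, norm_mul, norm_neg, norm_inv, realInnerSL, innerSL_apply_norm,
    Real.norm_of_nonneg hc.le, Real.norm_of_nonneg h.le, mul_assoc]
  gcongr
  nlinarith [gaussianProfile_le hA hc z, norm_sq_mul_gaussianProfile_le hA hc z,
    mul_nonneg h.le (sq_nonneg (‖z‖ - 1))]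

lemma gaussianProfileDeriv₂_apply (A c : ℝ) (z u v : E) :
    gaussianProfileDeriv₂ A c z u v =
      gaussianProfile A c z * (-⟪u, v⟫ / c + c⁻¹ ^ 2 * (⟪z, u⟫ * ⟪z, v⟫)) := by
  simp [gaussianProfileDeriv₂, gaussianProfileDeriv]
  ring

lemma norm_gaussianProfileDeriv₂_le {A c : ℝ} (hA : 0 < A) (hc : 0 < c) (z : E) :
    ‖gaussianProfileDeriv₂ A c z‖ ≤ A / c + c⁻¹ ^ 2 * (2 * c * A) := by
  have h := gaussianProfile_pos hA c z
  refine ContinuousLinearMap.opNorm_le_bound₂ _ (by positivity) fun u v => ?_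
  rw [gaussianProfileDeriv₂_apply, norm_mul, Real.norm_of_nonneg h.le]
  calc gaussianProfile A c z * ‖-⟪u, v⟫ / c + c⁻¹ ^ 2 * (⟪z, u⟫ * ⟪z, v⟫)‖
      ≤ gaussianProfile A c z *
          (‖u‖ * ‖v‖ / c + c⁻¹ ^ 2 * ((‖z‖ * ‖u‖) * (‖z‖ * ‖v‖))) := by
        gcongr
        refine (norm_add_le _ _).trans ?_
        rw [norm_div, norm_neg, norm_mul, norm_mul, Real.norm_of_nonneg hc.le, norm_pow, norm_inv,
          Real.norm_of_nonneg hc.le]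
        gcongr <;> exact norm_inner_le_norm _ _
    _ = (gaussianProfile A c z / c + c⁻¹ ^ 2 * (‖z‖ ^ 2 * gaussianProfile A c z))
          * ‖u‖ * ‖v‖ := by ring
    _ ≤ (A / c + c⁻¹ ^ 2 * (2 * c * A)) * ‖u‖ * ‖v‖ := by
        have h₁ := gaussianProfile_le hA hc z
        have h₂ := norm_sq_mul_gaussianProfile_le hA hc z
        refine mul_le_mul_of_nonneg_right (mul_le_mul_of_nonneg_right
          (add_le_add ?_ ?_) (norm_nonneg u)) (norm_nonneg v)
        · gcongr
        · exact mul_le_mul_of_nonneg_left h₂ (by positivity)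

end InnerProductSpace

end GaussianProfile

section Covariance

variable {E : Type*} [NormedAddCommGroup E] [InnerProductSpace ℝ E] [MeasurableSpace E]

lemma inner_integral_inner_smul_eq_covariance [CompleteSpace E] (ν : Measure E) [IsProbabilityMeasure ν]
    (h : MemLp id 2 ν) (u v : E) :
    ⟪∫ x, ⟪x - ∫ x, x ∂ν, u⟫ • (x - ∫ x, x ∂ν) ∂ν, v⟫
      = cov[fun x => ⟪x, u⟫, fun x => ⟪x, v⟫; ν] := by
  have hi : Integrable (fun x : E => x) ν := h.integrable one_le_two
  have hs : MemLp (fun x => x - ∫ x, x ∂ν) 2 ν := h.sub (memLp_const _)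
  have hgi : Integrable (fun x => ⟪x - ∫ x, x ∂ν, u⟫ • (x - ∫ x, x ∂ν)) ν :=
    memLp_one_iff_integrable.1 (hs.smul (hs.inner_const u))
  have hm : ∀ w : E, ∫ x, ⟪x, w⟫ ∂ν = ⟪∫ x, x ∂ν, w⟫ := fun w => by
    simp_rw [real_inner_comm w]
    exact integral_inner hi w
  rw [real_inner_comm, ← integral_inner hgi, covariance, hm, hm]
  refine integral_congr_ae (Filter.Eventually.of_forall fun x => ?_)
  simp only [inner_smul_right, ← inner_sub_left]
  rw [real_inner_comm v]

lemma covariance_inner_sub_smul (ν : Measure E) [IsProbabilityMeasure ν]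
    (h : MemLp id 2 ν) (s : ℝ) (y u v : E) :
    cov[fun x => ⟪y - s • x, u⟫, fun x => ⟪y - s • x, v⟫; ν]
      = s ^ 2 * cov[fun x => ⟪x, u⟫, fun x => ⟪x, v⟫; ν] := by
  have hi : ∀ w : E, Integrable (fun x => s * ⟪x, w⟫) ν := fun w =>
    ((h.inner_const w).integrable one_le_two).const_mul s
  simp only [inner_sub_left, real_inner_smul_left]
  rw [covariance_const_sub_left (hi u), covariance_const_sub_right (hi v),
    covariance_const_mul_left, covariance_const_mul_right]
  ring

end Covariance

section Hessian

variable {E : Type*} [NormedAddCommGroup E] [InnerProductSpace ℝ E] [MeasurableSpace E]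
  [BorelSpace E] [SecondCountableTopology E] [CompleteSpace E]

/-- The Hessian–covariance identity for the Gaussian smoothing `p` of `μ`, where `ν y` is the
posterior of the signal given the observation `y`. -/
theorem contDiff_and_iteratedFDeriv_two_log_gaussian_smoothing (μ : Measure E)
    [IsProbabilityMeasure μ] {A c s : ℝ} (hA : 0 < A) (hc : 0 < c) (hs : s ≠ 0)
    {φ : E → E → ℝ} (hφ : ∀ y x, φ y x = gaussianProfile A c (y - s • x))
    {p : E → ℝ} (hp : ∀ y, p y = ∫ x, φ y x ∂μ)
    {ν : E → Measure E}
    (hν : ∀ y, ν y = μ.withDensity fun x => ENNReal.ofReal (φ y x / p y))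
    {m : E → E} (hm : ∀ y, m y = ∫ x, x ∂(ν y))
    {Sig : E → E → E} (hSig : ∀ y u, Sig y u = ∫ x, ⟪x - m y, u⟫ • (x - m y) ∂(ν y)) :
    ContDiff ℝ 2 (fun z => Real.log (p z)) ∧
    ∀ y u v : E,
      iteratedFDeriv ℝ 2 (fun z => Real.log (p z)) y ![u, v]
        = -⟪u, v⟫ / c + (s ^ 2 / c ^ 2) * ⟪Sig y u, v⟫ := by
  have hgi : ∀ y, Integrable (fun x => gaussianProfile A c (y - s • x)) μ :=
    integrable_comp_sub_smul μ (continuous_gaussianProfile A c) (norm_gaussianProfile_le hA hc) s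
  have hgi' : ∀ y, Integrable (fun x => gaussianProfileDeriv A c (y - s • x)) μ :=
    integrable_comp_sub_smul μ (continuous_gaussianProfileDeriv A c)
      (norm_gaussianProfileDeriv_le hA hc) s
  have hgi'' := integrable_comp_sub_smul (F := E →L[ℝ] E →L[ℝ] ℝ) μ
    (continuous_gaussianProfileDeriv₂ A c)
    (norm_gaussianProfileDeriv₂_le hA hc) s
  have hpA : p = fun y => ∫ x, gaussianProfile A c (y - s • x) ∂μ :=
    funext fun y => by simp only [hp, hφ]
  have hp0 : ∀ y, 0 < p y := fun y => by
    rw [hpA]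
    refine (integral_pos_iff_support_of_nonneg
      (fun x => (gaussianProfile_pos hA c _).le) (hgi y)).2 ?_
    simp [Function.support_eq_univ fun x => (gaussianProfile_pos hA c (y - s • x)).ne']
  have hd : ∀ y, HasFDerivAt p (∫ x, gaussianProfileDeriv A c (y - s • x) ∂μ) y := fun y =>
    hpA ▸ hasFDerivAt_integral_comp_sub_smul μ (hasFDerivAt_gaussianProfile A c)
      (continuous_gaussianProfileDeriv A c) (norm_gaussianProfile_le hA hc)
      (norm_gaussianProfileDeriv_le hA hc) s y
  have hd' : ∀ y, HasFDerivAt (fun y => ∫ x, gaussianProfileDeriv A c (y - s • x) ∂μ)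
      (∫ x, gaussianProfileDeriv₂ A c (y - s • x) ∂μ) y :=
    hasFDerivAt_integral_comp_sub_smul μ (hasFDerivAt_gaussianProfileDeriv A c)
      (continuous_gaussianProfileDeriv₂ A c) (norm_gaussianProfileDeriv_le hA hc)
      (norm_gaussianProfileDeriv₂_le hA hc) s
  refine ⟨contDiff_two_log hd hd' (continuous_integral_comp_sub_smul μ
    (continuous_gaussianProfileDeriv₂ A c) (norm_gaussianProfileDeriv₂_le hA hc) s)
    fun y => (hp0 y).ne', fun y u v => ?_⟩
  rw [iteratedFDeriv_two_log hd hd' (fun y => (hp0 y).ne')]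
  have hw : ∀ x, 0 ≤ φ y x / p y := fun x => by
    rw [hφ]
    exact div_nonneg (gaussianProfile_pos hA c _).le (hp0 y).le
  have hmeas : Measurable fun x => ENNReal.ofReal (φ y x / p y) := by
    simp only [hφ]
    fun_prop
  have hνint : ∀ f : E → ℝ,
      ∫ x, f x ∂(ν y) = (∫ x, gaussianProfile A c (y - s • x) * f x ∂μ) / p y := fun f => by
    rw [hν, integral_withDensity_eq_integral_toReal_smul hmeas
      (Filter.Eventually.of_forall fun _ => ENNReal.ofReal_lt_top), ← integral_div]
    refine integral_congr_ae (Filter.Eventually.of_forall fun x => ?_)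
    simp only [ENNReal.toReal_ofReal (hw x), smul_eq_mul]
    rw [hφ]
    ring
  have : IsProbabilityMeasure (ν y) := ⟨by
    rw [hν, withDensity_apply _ MeasurableSet.univ, Measure.restrict_univ,
      ← ofReal_integral_eq_lintegral_ofReal ?_ (Filter.Eventually.of_forall hw), integral_div,
      ← hp, div_self (hp0 y).ne', ENNReal.ofReal_one]
    simp only [hφ]
    exact (hgi y).div_const _⟩
  have hz : MemLp (fun x => y - s • x) 2 (ν y) := by
    rw [memLp_two_iff_integrable_sq_norm (by fun_prop), hν,
      integrable_withDensity_iff_integrable_smul' hmeas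
      (Filter.Eventually.of_forall fun _ => ENNReal.ofReal_lt_top)]
    have h := (integrable_comp_sub_smul μ
      (g := fun z => ‖z‖ ^ 2 * gaussianProfile A c z) (by fun_prop) (C := 2 * c * A)
      (fun z => by
        rw [Real.norm_of_nonneg (mul_nonneg (sq_nonneg _) (gaussianProfile_pos hA c z).le)]
        exact norm_sq_mul_gaussianProfile_le hA hc z) s y).div_const (p y)
    refine h.congr (Filter.Eventually.of_forall fun x => ?_)
    simp only [ENNReal.toReal_ofReal (hw x), smul_eq_mul]
    rw [hφ]
    ring
  have hid : MemLp id 2 (ν y) := by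
    refine (((memLp_const y).sub hz).const_smul s⁻¹).ae_eq
      (Filter.Eventually.of_forall fun x => ?_)
    simp [smul_smul, inv_mul_cancel₀ hs]
  have hzi : ∀ w : E, MemLp (fun x => ⟪y - s • x, w⟫) 2 (ν y) :=
    fun w => hz.inner_const w
  have hP1 : ∀ w, (∫ x, gaussianProfileDeriv A c (y - s • x) ∂μ) w / p y
      = -c⁻¹ * ∫ x, ⟪y - s • x, w⟫ ∂(ν y) := fun w => by
    rw [ContinuousLinearMap.integral_apply (hgi' y), ← integral_const_mul, hνint]
    congr 2 with x
    simp only [gaussianProfileDeriv, smul_apply, realInnerSL_apply, smul_eq_mul]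
    ring
  have hP2 : (∫ x, gaussianProfileDeriv₂ A c (y - s • x) ∂μ) u v / p y
      = -⟪u, v⟫ / c + c⁻¹ ^ 2 * ∫ x, ⟪y - s • x, u⟫ * ⟪y - s • x, v⟫ ∂(ν y) := by
    have hmul : Integrable (fun x => ⟪y - s • x, u⟫ * ⟪y - s • x, v⟫) (ν y) :=
      (hzi u).integrable_mul (hzi v)
    have hcongr : ∫ x, (-⟪u, v⟫ / c + c⁻¹ ^ 2 * (⟪y - s • x, u⟫ * ⟪y - s • x, v⟫)) ∂(ν y)
        = -⟪u, v⟫ / c + c⁻¹ ^ 2 * ∫ x, ⟪y - s • x, u⟫ * ⟪y - s • x, v⟫ ∂(ν y) := by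
      rw [integral_add (integrable_const _) (hmul.const_mul _),
        integral_const_mul, integral_const, probReal_univ, one_smul]
    rw [ContinuousLinearMap.integral_apply (hgi'' y),
      ContinuousLinearMap.integral_apply ((hgi'' y).apply_continuousLinearMap u), ← hcongr, hνint]
    simp only [gaussianProfileDeriv₂_apply]
  have hcov := covariance_eq_sub (hzi u) (hzi v)
  simp only [Pi.mul_apply] at hcov
  rw [covariance_inner_sub_smul (ν y) hid, ← inner_integral_inner_smul_eq_covariance (ν y) hid,
    ← hm, ← hSig] at hcov
  rw [hP1, hP1, hP2]
  linear_combination -c⁻¹ ^ 2 * hcov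

end Hessian

/-- Hessian–covariance identity:
`∇² log p(y) = −(1/(1−ᾱ))·I + (ᾱ/(1−ᾱ)²)·Σ(y)` as a bilinear form. -/
theorem stmt_2 (n : ℕ) (hn : 1 ≤ n) (α : ℝ) (hα0 : 0 < α) (hα1 : α < 1)
    (μ : Measure (EuclideanSpace ℝ (Fin n))) [IsProbabilityMeasure μ]
    (φ : EuclideanSpace ℝ (Fin n) → EuclideanSpace ℝ (Fin n) → ℝ)
    (hφ : ∀ y x, φ y x = (2 * Real.pi * (1 - α)) ^ (-(n : ℝ) / 2) *
        Real.exp (-‖y - Real.sqrt α • x‖ ^ 2 / (2 * (1 - α))))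
    (p : EuclideanSpace ℝ (Fin n) → ℝ)
    (hp : ∀ y, p y = ∫ x, φ y x ∂μ)
    (ν : EuclideanSpace ℝ (Fin n) → Measure (EuclideanSpace ℝ (Fin n)))
    (hν : ∀ y, ν y = μ.withDensity fun x => ENNReal.ofReal (φ y x / p y))
    (m : EuclideanSpace ℝ (Fin n) → EuclideanSpace ℝ (Fin n))
    (hm : ∀ y, m y = ∫ x, x ∂(ν y))
    (Sig : EuclideanSpace ℝ (Fin n) → EuclideanSpace ℝ (Fin n) → EuclideanSpace ℝ (Fin n))
    (hSig : ∀ y u, Sig y u = ∫ x, ⟪x - m y, u⟫ • (x - m y) ∂(ν y)) :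
    ContDiff ℝ 2 (fun z => Real.log (p z)) ∧
    ∀ (y u v : EuclideanSpace ℝ (Fin n)),
      iteratedFDeriv ℝ 2 (fun z => Real.log (p z)) y ![u, v]
        = -⟪u, v⟫ / (1 - α) + (α / (1 - α) ^ 2) * ⟪Sig y u, v⟫ := by
  have hc : 0 < 1 - α := sub_pos.2 hα1
  simpa only [Real.sq_sqrt hα0.le] using
    contDiff_and_iteratedFDeriv_two_log_gaussian_smoothing μ
      (A := (2 * Real.pi * (1 - α)) ^ (-(n : ℝ) / 2)) (by positivity) hc
      (Real.sqrt_pos.2 hα0).ne' hφ hp hν hm hSig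
end

section
/- The posterior-mean map m : ℝⁿ → ℝⁿ is differentiable, and for every y ∈ ℝⁿ its (Fréchet) derivative is the linear map Dm(y) = (√ᾱ/(1 − ᾱ))·Σ(y); in particular Dm(y) is a symmetric positive-semidefinite operator. -/
open MeasureTheory
open scoped RealInnerProductSpace

section GaussianKernel

variable {E G : Type*} [NormedAddCommGroup E] [InnerProductSpace ℝ E]
  [NormedAddCommGroup G] [NormedSpace ℝ G]

/-- The unnormalised Gaussian kernel `y ↦ C · exp(-‖y - s x‖² / c)`. -/
noncomputable def gaussKernel (C s c : ℝ) (y x : E) : ℝ :=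
  C * Real.exp (-‖y - s • x‖ ^ 2 / c)

theorem gaussKernel_pos {C : ℝ} (hC : 0 < C) (s c : ℝ) (y x : E) : 0 < gaussKernel C s c y x :=
  mul_pos hC (Real.exp_pos _)

theorem continuous_gaussKernel (C s c : ℝ) (y : E) : Continuous (gaussKernel C s c y) := by
  unfold gaussKernel
  fun_prop

theorem gaussKernel_mul_sq_le {C s c : ℝ} (hC : 0 < C) (hs : 0 < s) (hc : 0 < c) (R : ℝ) :
    ∃ K, ∀ y : E, ‖y‖ ≤ R → ∀ x : E, gaussKernel C s c y x * (1 + ‖x‖) ^ 2 ≤ K := by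
  refine ⟨C * (2 * (1 + R / s) ^ 2 + 2 * c / s ^ 2), fun y hy x => ?_⟩
  unfold gaussKernel
  rw [mul_assoc]
  refine mul_le_mul_of_nonneg_left ?_ hC.le
  set t := ‖y - s • x‖ with ht
  have ht0 : 0 ≤ t := norm_nonneg _
  have hx : 1 + ‖x‖ ≤ (1 + R / s) + t / s := by
    have h : s * ‖x‖ ≤ t + R := by
      calc s * ‖x‖ = ‖s • x‖ := by rw [norm_smul, Real.norm_of_nonneg hs.le]
        _ ≤ ‖y - s • x‖ + ‖y‖ := by
          rw [← norm_neg (y - s • x)]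
          simpa using norm_add_le (-(y - s • x)) y
        _ ≤ t + R := by linarith
    have h' : ‖x‖ ≤ (t + R) / s := by rw [le_div_iff₀ hs]; linarith
    rw [add_div] at h'
    linarith
  have hsq : (1 + ‖x‖) ^ 2 ≤ 2 * (1 + R / s) ^ 2 + 2 * (t / s) ^ 2 := by
    have h1 : (1 + ‖x‖) ^ 2 ≤ ((1 + R / s) + t / s) ^ 2 := by gcongr
    nlinarith [sq_nonneg ((1 + R / s) - t / s)]
  have he1 : Real.exp (-t ^ 2 / c) ≤ 1 := by
    rw [Real.exp_le_one_iff, neg_div]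
    have : 0 ≤ t ^ 2 / c := by positivity
    linarith
  have he2 : Real.exp (-t ^ 2 / c) * t ^ 2 ≤ c := by
    have h := Real.add_one_le_exp (t ^ 2 / c)
    have h' : t ^ 2 ≤ c * Real.exp (t ^ 2 / c) := by
      have h2 : t ^ 2 / c ≤ Real.exp (t ^ 2 / c) := by linarith
      rw [div_le_iff₀ hc] at h2
      linarith
    rw [neg_div, Real.exp_neg, inv_mul_le_iff₀ (Real.exp_pos _)]
    linarith
  calc Real.exp (-t ^ 2 / c) * (1 + ‖x‖) ^ 2
      ≤ Real.exp (-t ^ 2 / c) * (2 * (1 + R / s) ^ 2 + 2 * (t / s) ^ 2) := by gcongr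
    _ = Real.exp (-t ^ 2 / c) * (2 * (1 + R / s) ^ 2)
        + 2 / s ^ 2 * (Real.exp (-t ^ 2 / c) * t ^ 2) := by ring
    _ ≤ 1 * (2 * (1 + R / s) ^ 2) + 2 / s ^ 2 * c := by gcongr
    _ = 2 * (1 + R / s) ^ 2 + 2 * c / s ^ 2 := by ring

theorem hasFDerivAt_gaussKernel (C s c : ℝ) (y x : E) :
    HasFDerivAt (fun y => gaussKernel C s c y x)
      ((-(2 / c) * gaussKernel C s c y x) • innerSL ℝ (y - s • x)) y := by
  unfold gaussKernel
  have h1 : HasFDerivAt (fun y : E => ‖y - s • x‖ ^ 2) (2 • innerSL ℝ (y - s • x)) y := by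
    simpa using ((hasFDerivAt_id y).sub_const (s • x)).norm_sq
  have h2 := ((h1.neg.mul_const c⁻¹).exp).const_mul C
  simp only [← div_eq_mul_inv] at h2
  refine h2.congr_fderiv ?_
  ext u
  simp
  ring

theorem norm_inner_smul_le_mul_sq (a b u : E) (x : E) :
    ‖⟪x - a, u⟫ • (x - b)‖ ≤ ((1 + ‖a‖) * ‖u‖ * (1 + ‖b‖)) * (1 + ‖x‖) ^ 2 := by
  have h (a : E) : ‖x - a‖ ≤ (1 + ‖a‖) * (1 + ‖x‖) := by
    nlinarith [norm_sub_le x a, norm_nonneg x, norm_nonneg a]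
  rw [norm_smul]
  calc ‖⟪x - a, u⟫‖ * ‖x - b‖ ≤ ((1 + ‖a‖) * (1 + ‖x‖) * ‖u‖) * ((1 + ‖b‖) * (1 + ‖x‖)) := by
        gcongr
        · exact (norm_inner_le_norm _ _).trans (by gcongr; exact h a)
        · exact h b
    _ = _ := by ring

variable [MeasurableSpace E] [BorelSpace E] (μ : Measure E)

/-- The posterior measure with prior `μ` and Gaussian likelihood `gaussKernel C s c y`. -/
noncomputable def gaussPosterior (C s c : ℝ) (y : E) : Measure E :=
  μ.withDensity fun x =>
    ENNReal.ofReal (gaussKernel C s c y x / ∫ x, gaussKernel C s c y x ∂μ)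

theorem integral_gaussPosterior {C s c : ℝ} (hC : 0 < C) (y : E) (g : E → G) :
    ∫ x, g x ∂(gaussPosterior μ C s c y) =
      (∫ x, gaussKernel C s c y x ∂μ)⁻¹ • ∫ x, gaussKernel C s c y x • g x ∂μ := by
  have hp : 0 ≤ ∫ x, gaussKernel C s c y x ∂μ :=
    integral_nonneg fun x => (gaussKernel_pos hC s c y x).le
  have hm := (continuous_gaussKernel C s c y).measurable
  rw [gaussPosterior, integral_withDensity_eq_integral_toReal_smul
    (hm.div_const _).ennreal_ofReal (.of_forall fun x => ENNReal.ofReal_lt_top), ← integral_smul]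
  refine integral_congr_ae (.of_forall fun x => ?_)
  simp only [smul_smul]
  rw [ENNReal.toReal_ofReal (div_nonneg (gaussKernel_pos hC s c y x).le hp), div_eq_inv_mul]

variable [SecondCountableTopology E] [IsProbabilityMeasure μ]

theorem integrable_gaussKernel_smul {C s c : ℝ} (hC : 0 < C) (hs : 0 < s) (hc : 0 < c)
    {g : E → G} (hg : Continuous g) {D : ℝ} (hD : ∀ x, ‖g x‖ ≤ D * (1 + ‖x‖) ^ 2) (y : E) :
    Integrable (fun x => gaussKernel C s c y x • g x) μ := by
  obtain ⟨K, hK⟩ := gaussKernel_mul_sq_le (E := E) hC hs hc ‖y‖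
  have hD0 : 0 ≤ D := by simpa using (norm_nonneg _).trans (hD 0)
  refine (integrable_const (D * K)).mono'
    ((continuous_gaussKernel C s c y).smul hg).aestronglyMeasurable (.of_forall fun x => ?_)
  have hk := (gaussKernel_pos hC s c y x).le
  rw [norm_smul, Real.norm_of_nonneg hk]
  calc gaussKernel C s c y x * ‖g x‖
      ≤ gaussKernel C s c y x * (D * (1 + ‖x‖) ^ 2) := by gcongr; exact hD x
    _ = D * (gaussKernel C s c y x * (1 + ‖x‖) ^ 2) := by ring
    _ ≤ D * K := by gcongr; exact hK y le_rfl x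

theorem exists_hasFDerivAt_integral_gaussKernel_smul {C s c : ℝ} (hC : 0 < C) (hs : 0 < s)
    (hc : 0 < c) {g : E → G} (hg : Continuous g) {D : ℝ} (hD : ∀ x, ‖g x‖ ≤ D * (1 + ‖x‖))
    (y : E) :
    ∃ L : E →L[ℝ] G, HasFDerivAt (fun y => ∫ x, gaussKernel C s c y x • g x ∂μ) L y ∧
      ∀ u, L u = ∫ x, gaussKernel C s c y x • ((-(2 / c) * ⟪y - s • x, u⟫) • g x) ∂μ := by
  have hD0 : 0 ≤ D := by simpa using (norm_nonneg _).trans (hD 0)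
  have hD2 : ∀ x, ‖g x‖ ≤ D * (1 + ‖x‖) ^ 2 := fun x => (hD x).trans <| by
    have := norm_nonneg x
    gcongr
    nlinarith
  set F' : E → E → E →L[ℝ] G := fun y x =>
    ((-(2 / c) * gaussKernel C s c y x) • innerSL ℝ (y - s • x)).smulRight (g x) with hF'
  obtain ⟨K, hK⟩ := gaussKernel_mul_sq_le (E := E) hC hs hc (‖y‖ + 1)
  have hcont : ∀ y, Continuous (F' y) := fun y => by
    have h1 := continuous_gaussKernel C s c y
    have h2 : Continuous fun x : E =>
        (-(2 / c) * gaussKernel C s c y x) • innerSL ℝ (y - s • x) := by fun_prop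
    exact ((ContinuousLinearMap.smulRightL ℝ E G).continuous.comp h2).clm_apply hg
  have hbound : ∀ x, ∀ z ∈ Metric.ball y 1,
      ‖F' z x‖ ≤ 2 / c * (‖y‖ + 1 + s) * D * K := by
    intro x z hz
    have hz' : ‖z‖ ≤ ‖y‖ + 1 := by
      have : ‖z - y‖ < 1 := by rwa [← dist_eq_norm]
      linarith [norm_sub_norm_le z y]
    have hk := (gaussKernel_pos hC s c z x).le
    have hzx : ‖z - s • x‖ ≤ (‖y‖ + 1 + s) * (1 + ‖x‖) := by
      have h1 := norm_sub_le z (s • x)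
      rw [norm_smul, Real.norm_of_nonneg hs.le] at h1
      nlinarith [norm_nonneg x, norm_nonneg y]
    rw [hF', ContinuousLinearMap.norm_smulRight_apply, norm_smul, norm_mul, norm_neg,
      innerSL_apply_norm, Real.norm_of_nonneg hk, Real.norm_of_nonneg (by positivity)]
    calc 2 / c * gaussKernel C s c z x * ‖z - s • x‖ * ‖g x‖
        ≤ 2 / c * gaussKernel C s c z x * ((‖y‖ + 1 + s) * (1 + ‖x‖)) * (D * (1 + ‖x‖)) := by
          gcongr
          exact hD x
      _ = 2 / c * (‖y‖ + 1 + s) * D * (gaussKernel C s c z x * (1 + ‖x‖) ^ 2) := by ring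
      _ ≤ 2 / c * (‖y‖ + 1 + s) * D * K := by gcongr; exact hK z hz' x
  refine ⟨∫ x, F' y x ∂μ, ?_, fun u => ?_⟩
  · refine hasFDerivAt_integral_of_dominated_of_fderiv_le (Metric.ball_mem_nhds y one_pos)
      (.of_forall fun z => (integrable_gaussKernel_smul μ hC hs hc hg hD2 z).aestronglyMeasurable)
      (integrable_gaussKernel_smul μ hC hs hc hg hD2 y) (hcont y).aestronglyMeasurable
      (.of_forall hbound) (integrable_const _) (.of_forall fun x z _ => ?_)
    exact (hasFDerivAt_gaussKernel C s c z x).smul_const (g x)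
  · have hint : Integrable (F' y) μ := (integrable_const _).mono' (hcont y).aestronglyMeasurable
      (.of_forall fun x => hbound x y (Metric.mem_ball_self one_pos))
    rw [ContinuousLinearMap.integral_apply hint]
    refine integral_congr_ae (.of_forall fun x => ?_)
    simp only [hF', ContinuousLinearMap.smulRight_apply, smul_smul, _root_.smul_apply,
      innerSL_apply_apply, smul_eq_mul]
    congr 1
    ring

theorem integral_gaussKernel_pos {C s c : ℝ} (hC : 0 < C) (hs : 0 < s) (hc : 0 < c) (y : E) :
    0 < ∫ x, gaussKernel C s c y x ∂μ := by
  have hint : Integrable (gaussKernel C s c y) μ := by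
    simpa using integrable_gaussKernel_smul μ hC hs hc (g := fun _ => (1 : ℝ)) continuous_const
      (D := 1) (fun x => by
        have := norm_nonneg x
        simp only [norm_one, one_mul]
        nlinarith) y
  rw [integral_pos_iff_support_of_nonneg (fun x => (gaussKernel_pos hC s c y x).le) hint]
  have : Function.support (gaussKernel C s c y) = Set.univ :=
    Set.eq_univ_of_forall fun x => (gaussKernel_pos hC s c y x).ne'
  simp [this]

theorem integrable_gaussPosterior {C s c : ℝ} (hC : 0 < C) (hs : 0 < s) (hc : 0 < c)
    {g : E → G} (hg : Continuous g) {D : ℝ} (hD : ∀ x, ‖g x‖ ≤ D * (1 + ‖x‖) ^ 2) (y : E) :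
    Integrable g (gaussPosterior μ C s c y) := by
  have hm := (continuous_gaussKernel C s c y).measurable
  rw [gaussPosterior, integrable_withDensity_iff_integrable_smul'
    (hm.div_const _).ennreal_ofReal (.of_forall fun x => ENNReal.ofReal_lt_top)]
  refine ((integrable_gaussKernel_smul μ hC hs hc hg hD y).smul
    (∫ x, gaussKernel C s c y x ∂μ)⁻¹).congr (.of_forall fun x => ?_)
  simp only [Pi.smul_apply, smul_smul]
  rw [ENNReal.toReal_ofReal (div_nonneg (gaussKernel_pos hC s c y x).le
    (integral_gaussKernel_pos μ hC hs hc y).le), div_eq_inv_mul]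

theorem isProbabilityMeasure_gaussPosterior {C s c : ℝ} (hC : 0 < C) (hs : 0 < s) (hc : 0 < c)
    (y : E) : IsProbabilityMeasure (gaussPosterior μ C s c y) := by
  have h := integral_gaussPosterior μ (s := s) (c := c) hC y (fun _ => (1 : ℝ))
  have hp := (integral_gaussKernel_pos μ hC hs hc y).ne'
  simp only [smul_eq_mul, mul_one, integral_const, inv_mul_cancel₀ hp] at h
  exact ⟨by simpa [Measure.real, ENNReal.toReal_eq_one_iff] using h⟩

/-- The posterior mean is differentiable, with derivative a multiple of the posterior covariance. -/
theorem exists_hasFDerivAt_gaussPosterior_mean [CompleteSpace E] {C s c : ℝ} (hC : 0 < C)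
    (hs : 0 < s) (hc : 0 < c) (y : E) :
    ∃ L : E →L[ℝ] E, HasFDerivAt (fun y => ∫ x, x ∂(gaussPosterior μ C s c y)) L y ∧
      ∀ u, L u = (2 * s / c) • ∫ x, ⟪x - ∫ x, x ∂(gaussPosterior μ C s c y), u⟫ •
        (x - ∫ x, x ∂(gaussPosterior μ C s c y)) ∂(gaussPosterior μ C s c y) := by
  have hlin : ∀ x : E, ‖x‖ ≤ 1 * (1 + ‖x‖) := fun x => by linarith
  have hone : ∀ x : E, ‖(1 : ℝ)‖ ≤ 1 * (1 + ‖x‖) := fun x => by simp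
  obtain ⟨Lp, hLp, hLpu⟩ := exists_hasFDerivAt_integral_gaussKernel_smul μ hC hs hc
    (g := fun _ => (1 : ℝ)) continuous_const hone y
  obtain ⟨LN, hLN, hLNu⟩ := exists_hasFDerivAt_integral_gaussKernel_smul μ hC hs hc
    (g := fun x : E => x) continuous_id hlin y
  simp only [smul_eq_mul, mul_one] at hLp
  have hp := (integral_gaussKernel_pos μ hC hs hc y).ne'
  have hprob := isProbabilityMeasure_gaussPosterior μ hC hs hc y
  have hm := integral_gaussPosterior μ (s := s) (c := c) hC y (fun x => x)
  have hderiv := ((hasDerivAt_inv hp).comp_hasFDerivAt y hLp).smul hLN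
  refine ⟨_, hderiv.congr_of_eventuallyEq (.of_forall fun z =>
    integral_gaussPosterior μ (s := s) (c := c) hC z (fun x => x)), fun u => ?_⟩
  have hLp' : (∫ x, gaussKernel C s c y x ∂μ)⁻¹ * Lp u =
      ∫ x, -(2 / c) * ⟪y - s • x, u⟫ ∂(gaussPosterior μ C s c y) := by
    rw [integral_gaussPosterior μ hC, hLpu]
    simp
  have hLN' : (∫ x, gaussKernel C s c y x ∂μ)⁻¹ • LN u =
      ∫ x, (-(2 / c) * ⟪y - s • x, u⟫) • x ∂(gaussPosterior μ C s c y) := by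
    rw [integral_gaussPosterior μ hC, hLNu]
  set P := gaussPosterior μ C s c y
  set m := ∫ x, x ∂P with hmdef
  set p := ∫ x, gaussKernel C s c y x ∂μ
  have hintx : Integrable (fun x : E => x) P :=
    integrable_gaussPosterior μ hC hs hc continuous_id (D := 1)
      (fun x => by simp only [id]; nlinarith [norm_nonneg x]) y
  have hinti : Integrable (fun x : E => -(2 / c) * ⟪y - s • x, u⟫) P :=
    ((((integrable_const y).sub (hintx.smul s)).inner_const u).const_mul _)
  have hq (a b : E) : Integrable (fun x => ⟪x - a, u⟫ • (x - b)) P :=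
    integrable_gaussPosterior μ hC hs hc (by fun_prop) (norm_inner_smul_le_mul_sq a b u) y
  have hintix : Integrable (fun x : E => (-(2 / c) * ⟪y - s • x, u⟫) • x) P := by
    refine ((hq (s⁻¹ • y) 0).smul (2 / c * s)).congr (.of_forall fun x => ?_)
    simp only [Pi.smul_apply, smul_smul, sub_zero, inner_sub_left, real_inner_smul_left]
    congr 1
    field_simp
    ring
  have hcentre : ∫ x, (x - m) ∂P = 0 := by
    rw [integral_sub hintx (integrable_const _)]
    simp [hmdef]
  calc _ = p⁻¹ • LN u - (p⁻¹ * Lp u) • m := by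
        rw [hm]
        simp only [add_apply, _root_.smul_apply, ContinuousLinearMap.smulRight_apply,
          Function.comp_apply, smul_smul, smul_eq_mul, sub_eq_add_neg, ← neg_smul]
        congr 2
        ring
    _ = ∫ x, (-(2 / c) * ⟪y - s • x, u⟫) • (x - m) ∂P := by
        rw [hLN', hLp', ← integral_smul_const, ← integral_sub hintix (hinti.smul_const m)]
        simp only [smul_sub]
    _ = ∫ x, ((-(2 / c) * ⟪y - s • m, u⟫) • (x - m) +
          (2 * s / c) • (⟪x - m, u⟫ • (x - m))) ∂P := by
        refine integral_congr_ae (.of_forall fun x => ?_)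
        simp only [smul_smul, ← add_smul, inner_sub_left, real_inner_smul_left]
        congr 1
        ring
    _ = _ := by
        have h1 : Integrable (fun x => (-(2 / c) * ⟪y - s • m, u⟫) • (x - m)) P :=
          (hintx.sub (integrable_const m)).smul _
        have h2 : Integrable (fun x => (2 * s / c) • (⟪x - m, u⟫ • (x - m))) P :=
          (hq m m).smul _
        rw [integral_add h1 h2, integral_smul, integral_smul, hcentre, smul_zero, zero_add]

end GaussianKernel

/-- The posterior-mean map is differentiable with derivative `(√ᾱ/(1−ᾱ))·Σ(y)`,
a symmetric positive-semidefinite operator. -/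
theorem stmt_3 (n : ℕ) (hn : 1 ≤ n) (α : ℝ) (hα0 : 0 < α) (hα1 : α < 1)
    (μ : Measure (EuclideanSpace ℝ (Fin n))) [IsProbabilityMeasure μ]
    (φ : EuclideanSpace ℝ (Fin n) → EuclideanSpace ℝ (Fin n) → ℝ)
    (hφ : ∀ y x, φ y x = (2 * Real.pi * (1 - α)) ^ (-(n : ℝ) / 2) *
        Real.exp (-‖y - Real.sqrt α • x‖ ^ 2 / (2 * (1 - α))))
    (p : EuclideanSpace ℝ (Fin n) → ℝ)
    (hp : ∀ y, p y = ∫ x, φ y x ∂μ)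
    (ν : EuclideanSpace ℝ (Fin n) → Measure (EuclideanSpace ℝ (Fin n)))
    (hν : ∀ y, ν y = μ.withDensity fun x => ENNReal.ofReal (φ y x / p y))
    (m : EuclideanSpace ℝ (Fin n) → EuclideanSpace ℝ (Fin n))
    (hm : ∀ y, m y = ∫ x, x ∂(ν y))
    (Sig : EuclideanSpace ℝ (Fin n) → EuclideanSpace ℝ (Fin n) → EuclideanSpace ℝ (Fin n))
    (hSig : ∀ y u, Sig y u = ∫ x, ⟪x - m y, u⟫ • (x - m y) ∂(ν y)) :
    Differentiable ℝ m ∧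
    (∀ y u, fderiv ℝ m y u = (Real.sqrt α / (1 - α)) • Sig y u) ∧
    (∀ y u v, ⟪fderiv ℝ m y u, v⟫ = ⟪u, fderiv ℝ m y v⟫) ∧
    (∀ y u, 0 ≤ ⟪fderiv ℝ m y u, u⟫) := by
  have hα : 0 < 1 - α := by linarith
  have hs : 0 < Real.sqrt α := Real.sqrt_pos.2 hα0
  have hc : 0 < 2 * (1 - α) := by linarith
  have hC : 0 < (2 * Real.pi * (1 - α)) ^ (-(n : ℝ) / 2) :=
    Real.rpow_pos_of_pos (mul_pos Real.two_pi_pos hα) _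
  set C := (2 * Real.pi * (1 - α)) ^ (-(n : ℝ) / 2)
  set s := Real.sqrt α
  have hν' : ∀ y, ν y = gaussPosterior μ C s (2 * (1 - α)) y := fun y => by
    simp only [hν, hp, hφ, gaussPosterior, gaussKernel]
  have hm' : m = fun y => ∫ x, x ∂(gaussPosterior μ C s (2 * (1 - α)) y) := by
    funext y
    rw [hm, hν']
  have key : ∀ y, ∃ L : EuclideanSpace ℝ (Fin n) →L[ℝ] EuclideanSpace ℝ (Fin n),
      HasFDerivAt m L y ∧ ∀ u, L u = (s / (1 - α)) • Sig y u := fun y => by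
    obtain ⟨L, hL, hLu⟩ := exists_hasFDerivAt_gaussPosterior_mean μ hC hs hc y
    refine ⟨L, hm' ▸ hL, fun u => ?_⟩
    rw [hLu, hSig, hm, hν', mul_div_mul_left _ _ two_ne_zero]
  have hfd : ∀ y u, fderiv ℝ m y u = (s / (1 - α)) • Sig y u := fun y u => by
    obtain ⟨L, hL, hLu⟩ := key y
    rw [hL.fderiv, hLu]
  have hinner : ∀ y u v, ⟪Sig y u, v⟫ = ∫ x, ⟪x - m y, u⟫ * ⟪x - m y, v⟫ ∂(ν y) := by
    intro y u v
    have hint : Integrable (fun x => ⟪x - m y, u⟫ • (x - m y)) (ν y) := by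
      rw [hν']
      exact integrable_gaussPosterior μ hC hs hc (by fun_prop)
        (norm_inner_smul_le_mul_sq (m y) (m y) u) y
    rw [hSig, real_inner_comm, ← integral_inner hint]
    refine integral_congr_ae (.of_forall fun x => ?_)
    simp only [real_inner_smul_right, real_inner_comm v]
  refine ⟨fun y => (key y).choose_spec.1.differentiableAt, hfd, fun y u v => ?_, fun y u => ?_⟩
  · rw [hfd, hfd, real_inner_smul_left, real_inner_smul_right, real_inner_comm (Sig y v), hinner,
      hinner]
    simp only [mul_comm]
  · rw [hfd, real_inner_smul_left, hinner]
    exact mul_nonneg (by positivity) (integral_nonneg fun x => mul_self_nonneg _)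
end

section
/- (Lemma 1: variance guidance is covariance-rescaled mean guidance.) Let g : ℝⁿ → ℝ be a function and y ∈ ℝⁿ a point such that g is differentiable at m(y). Then the composite y ↦ g(m(y)) is differentiable at y, and for every ρ ∈ ℝ the variance-guidance vector Δ := ρ·∇_y[g(m(y))] satisfies Δ = ρ·(√ᾱ/(1 − ᾱ))·Σ(y)·∇g(m(y)). In particular, taking g to be the (log of the) smoothed target predictor, the gradient with respect to x_t of the predictor evaluated at the predicted clean sample equals the posterior covariance Σ(y), scaled by √ᾱ/(1 − ᾱ), applied to the gradient with respect to the predicted clean sample itself. -/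
open MeasureTheory
open scoped RealInnerProductSpace

section GaussianWeight

variable {E F : Type*} [NormedAddCommGroup E] [InnerProductSpace ℝ E]
  [NormedAddCommGroup F] [NormedSpace ℝ F]

/-- The unnormalised Gaussian transition weight with signal level `s` and variance `c`. -/
noncomputable def gaussianWeight (c s : ℝ) (y x : E) : ℝ :=
  Real.exp (-‖y - s • x‖ ^ 2 / (2 * c))

lemma gaussianWeight_pos (c s : ℝ) (y x : E) : 0 < gaussianWeight c s y x := Real.exp_pos _

lemma continuous_gaussianWeight (c s : ℝ) (y : E) : Continuous (gaussianWeight c s y) := by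
  unfold gaussianWeight; fun_prop

lemma gaussianWeight_mul_sq_le {c s : ℝ} (hc : 0 < c) (hs : 0 < s) (R : ℝ) :
    ∃ K, ∀ y x : E, ‖y‖ ≤ R → gaussianWeight c s y x * (1 + ‖x‖) ^ 2 ≤ K := by
  refine ⟨2 * (1 + R / s) ^ 2 + 4 * c / s ^ 2, fun y x hy ↦ ?_⟩
  set t := ‖y - s • x‖ with ht
  have hx : ‖x‖ ≤ (R + t) / s := by
    rw [le_div_iff₀ hs]
    have := norm_sub_le y (y - s • x)
    rw [sub_sub_cancel, norm_smul, Real.norm_of_nonneg hs.le] at this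
    linarith
  have hsq : (1 + ‖x‖) ^ 2 ≤ 2 * (1 + R / s) ^ 2 + 2 * (t / s) ^ 2 := by
    have h1 : 1 + ‖x‖ ≤ (1 + R / s) + t / s := by rw [add_div] at hx; linarith
    have h2 : (1 + ‖x‖) ^ 2 ≤ ((1 + R / s) + t / s) ^ 2 := by gcongr
    nlinarith [sq_nonneg ((1 + R / s) - t / s)]
  have hw1 : gaussianWeight c s y x ≤ 1 :=
    Real.exp_le_one_iff.2 (div_nonpos_of_nonpos_of_nonneg (by simp) (by positivity))
  have hwt : gaussianWeight c s y x * t ^ 2 ≤ 2 * c := by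
    have h := Real.add_one_le_exp (t ^ 2 / (2 * c))
    have h2 : t ^ 2 ≤ 2 * c * Real.exp (t ^ 2 / (2 * c)) := by
      have : t ^ 2 / (2 * c) ≤ Real.exp (t ^ 2 / (2 * c)) := by linarith
      rwa [div_le_iff₀' (by positivity)] at this
    calc gaussianWeight c s y x * t ^ 2
        ≤ gaussianWeight c s y x * (2 * c * Real.exp (t ^ 2 / (2 * c))) := by
          gcongr; exact (gaussianWeight_pos ..).le
      _ = 2 * c * (Real.exp (-t ^ 2 / (2 * c)) * Real.exp (t ^ 2 / (2 * c))) := by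
          rw [gaussianWeight]; ring
      _ = 2 * c := by rw [← Real.exp_add, neg_div, neg_add_cancel, Real.exp_zero, mul_one]
  calc gaussianWeight c s y x * (1 + ‖x‖) ^ 2
      ≤ gaussianWeight c s y x * (2 * (1 + R / s) ^ 2 + 2 * (t / s) ^ 2) := by
        gcongr; exact (gaussianWeight_pos ..).le
    _ = gaussianWeight c s y x * (2 * (1 + R / s) ^ 2)
        + 2 / s ^ 2 * (gaussianWeight c s y x * t ^ 2) := by ring
    _ ≤ 1 * (2 * (1 + R / s) ^ 2) + 2 / s ^ 2 * (2 * c) := by gcongr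
    _ = 2 * (1 + R / s) ^ 2 + 4 * c / s ^ 2 := by ring

lemma hasFDerivAt_gaussianWeight (c s : ℝ) (y x : E) :
    HasFDerivAt (fun z ↦ gaussianWeight c s z x)
      (gaussianWeight c s y x • (-(1 / c)) • innerSL ℝ (y - s • x)) y := by
  have h := ((((hasFDerivAt_id (𝕜 := ℝ) y).sub_const (s • x)).norm_sq).neg.mul_const
    ((2 * c)⁻¹)).exp
  simp only [← div_eq_mul_inv] at h
  refine h.congr_fderiv ?_
  ext u
  simp [gaussianWeight, innerSL_apply_apply]
  ring

lemma norm_smulRight_score_le (c s : ℝ) {y x : E} {R : ℝ} (hy : ‖y‖ ≤ R)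
    {v : F} (hv : ‖v‖ ≤ 1 + ‖x‖) :
    ‖((-(1 / c)) • innerSL ℝ (y - s • x)).smulRight v‖
      ≤ |1 / c| * (R + |s|) * (1 + ‖x‖) ^ 2 := by
  have hR : 0 ≤ R := (norm_nonneg _).trans hy
  have h1 : ‖y - s • x‖ ≤ (R + |s|) * (1 + ‖x‖) := by
    have := norm_sub_le y (s • x)
    rw [norm_smul, Real.norm_eq_abs] at this
    nlinarith [mul_nonneg hR (norm_nonneg x), abs_nonneg s]
  rw [ContinuousLinearMap.norm_smulRight_apply, norm_smul, norm_neg, Real.norm_eq_abs,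
    innerSL_apply_norm]
  calc |1 / c| * ‖y - s • x‖ * ‖v‖
      ≤ |1 / c| * ((R + |s|) * (1 + ‖x‖)) * (1 + ‖x‖) := by gcongr
    _ = |1 / c| * (R + |s|) * (1 + ‖x‖) ^ 2 := by ring

lemma norm_smul_inner_sub_le (a u x : E) :
    ‖⟪x - a, u⟫ • (x - a)‖ ≤ ‖u‖ * (1 + ‖a‖) ^ 2 * (1 + ‖x‖) ^ 2 := by
  have h1 : ‖x - a‖ ≤ (1 + ‖a‖) * (1 + ‖x‖) := by
    nlinarith [norm_sub_le x a, norm_nonneg x, norm_nonneg a,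
      mul_nonneg (norm_nonneg x) (norm_nonneg a)]
  rw [norm_smul]
  calc _ ≤ ‖x - a‖ * ‖u‖ * ‖x - a‖ := by gcongr; exact norm_inner_le_norm _ _
    _ ≤ ((1 + ‖a‖) * (1 + ‖x‖)) * ‖u‖ * ((1 + ‖a‖) * (1 + ‖x‖)) := by gcongr
    _ = _ := by ring

variable [MeasurableSpace E] [BorelSpace E] (μ : Measure E)

lemma integral_withDensity_gaussianWeight {c s C : ℝ} (hC : 0 < C) (y : E) (f : E → F) :
    ∫ x, f x ∂(μ.withDensity fun x ↦ ENNReal.ofReal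
        (C * gaussianWeight c s y x / ∫ x, C * gaussianWeight c s y x ∂μ))
      = (∫ x, gaussianWeight c s y x ∂μ)⁻¹ • ∫ x, gaussianWeight c s y x • f x ∂μ := by
  have hcont := continuous_gaussianWeight c s y
  rw [integral_withDensity_eq_integral_toReal_smul
    (by exact ((hcont.const_mul C).div_const _).measurable.ennreal_ofReal) (by simp),
    ← integral_smul, integral_const_mul]
  congr with x
  have hZ : 0 ≤ ∫ x, gaussianWeight c s y x ∂μ :=
    integral_nonneg fun x ↦ (gaussianWeight_pos c s y x).le
  have hw := gaussianWeight_pos c s y x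
  rw [ENNReal.toReal_ofReal (by positivity), mul_div_mul_left _ _ hC.ne', smul_smul,
    div_eq_inv_mul]

variable [SecondCountableTopology E] [IsFiniteMeasure μ]

lemma integrable_gaussianWeight_smul {c s : ℝ} (hc : 0 < c) (hs : 0 < s) (y : E) {h : E → F}
    (hcont : Continuous h) (A : ℝ) (hA : ∀ x, ‖h x‖ ≤ A * (1 + ‖x‖) ^ 2) :
    Integrable (fun x ↦ gaussianWeight c s y x • h x) μ := by
  obtain ⟨K, hK⟩ := gaussianWeight_mul_sq_le (E := E) hc hs ‖y‖
  have hA0 : 0 ≤ A := by simpa using (norm_nonneg _).trans (hA 0)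
  refine Integrable.of_bound
    (((continuous_gaussianWeight c s y).smul hcont).aestronglyMeasurable) (A * K)
    (.of_forall fun x ↦ ?_)
  have hw := (gaussianWeight_pos c s y x).le
  rw [norm_smul, Real.norm_of_nonneg hw]
  calc gaussianWeight c s y x * ‖h x‖
      ≤ gaussianWeight c s y x * (A * (1 + ‖x‖) ^ 2) := by gcongr; exact hA x
    _ = A * (gaussianWeight c s y x * (1 + ‖x‖) ^ 2) := by ring
    _ ≤ A * K := by gcongr; exact hK y x le_rfl

lemma integrable_fderiv_gaussianWeight_smul {c s : ℝ} (hc : 0 < c) (hs : 0 < s) (y : E)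
    {h : E → F} (hcont : Continuous h) (hh : ∀ x, ‖h x‖ ≤ 1 + ‖x‖) :
    Integrable (fun x ↦ gaussianWeight c s y x •
      ((-(1 / c)) • innerSL ℝ (y - s • x)).smulRight (h x)) μ :=
  integrable_gaussianWeight_smul μ hc hs y (by fun_prop) _
    fun x ↦ norm_smulRight_score_le c s le_rfl (hh x)

lemma hasFDerivAt_integral_gaussianWeight_smul {c s : ℝ} (hc : 0 < c) (hs : 0 < s) (y : E)
    {h : E → F} (hcont : Continuous h) (hh : ∀ x, ‖h x‖ ≤ 1 + ‖x‖) :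
    HasFDerivAt (fun z ↦ ∫ x, gaussianWeight c s z x • h x ∂μ)
      (∫ x, gaussianWeight c s y x •
        ((-(1 / c)) • innerSL ℝ (y - s • x)).smulRight (h x) ∂μ) y := by
  obtain ⟨K, hK⟩ := gaussianWeight_mul_sq_le (E := E) hc hs (‖y‖ + 1)
  refine hasFDerivAt_integral_of_dominated_of_fderiv_le
    (F := fun z x ↦ gaussianWeight c s z x • h x)
    (F' := fun z x ↦ gaussianWeight c s z x •
      ((-(1 / c)) • innerSL ℝ (z - s • x)).smulRight (h x))
    (bound := fun _ ↦ |1 / c| * (‖y‖ + 1 + |s|) * K)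
    (Metric.ball_mem_nhds y one_pos)
    (.of_forall fun z ↦ ((continuous_gaussianWeight c s z).smul hcont).aestronglyMeasurable)
    (integrable_gaussianWeight_smul μ hc hs y hcont 1 fun x ↦ ?_)
    (integrable_fderiv_gaussianWeight_smul μ hc hs y hcont hh).aestronglyMeasurable
    (.of_forall fun x z hz ↦ ?_) (integrable_const _) (.of_forall fun x z _ ↦ ?_)
  · nlinarith [hh x, norm_nonneg x]
  · have hzR : ‖z‖ ≤ ‖y‖ + 1 := by
      have := norm_le_norm_add_norm_sub' z y
      rw [mem_ball_iff_norm] at hz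
      linarith
    rw [norm_smul, Real.norm_of_nonneg (gaussianWeight_pos c s z x).le]
    calc _ ≤ gaussianWeight c s z x * (|1 / c| * (‖y‖ + 1 + |s|) * (1 + ‖x‖) ^ 2) := by
          gcongr
          · exact (gaussianWeight_pos c s z x).le
          · exact norm_smulRight_score_le c s hzR (hh x)
      _ = |1 / c| * (‖y‖ + 1 + |s|) * (gaussianWeight c s z x * (1 + ‖x‖) ^ 2) := by ring
      _ ≤ _ := by gcongr; exact hK z x hzR
  · refine ((hasFDerivAt_gaussianWeight c s z x).smul_const (h x)).congr_fderiv ?_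
    ext u
    simp [smul_smul, mul_assoc]

lemma integral_gaussianWeight_pos [NeZero μ] {c s : ℝ} (hc : 0 < c) (hs : 0 < s) (y : E) :
    0 < ∫ x, gaussianWeight c s y x ∂μ := by
  have hint : Integrable (gaussianWeight c s y) μ := by
    simpa using integrable_gaussianWeight_smul μ hc hs y (h := fun _ ↦ (1 : ℝ))
      continuous_const 1 fun x ↦ by rw [norm_one]; nlinarith [norm_nonneg x]
  rw [integral_pos_iff_support_of_nonneg (fun x ↦ (gaussianWeight_pos c s y x).le) hint,
    Function.support_eq_univ fun x ↦ (gaussianWeight_pos c s y x).ne']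
  exact NeZero.pos _

lemma integrable_gaussianWeight_smul_inner_sub {c s : ℝ} (hc : 0 < c) (hs : 0 < s) (y a u : E) :
    Integrable (fun x ↦ gaussianWeight c s y x • ⟪x - a, u⟫ • (x - a)) μ :=
  integrable_gaussianWeight_smul μ hc hs y (by fun_prop) _ fun x ↦ norm_smul_inner_sub_le a u x

/-- The derivative of the posterior mean is the posterior covariance scaled by `s / c`. -/
lemma exists_hasFDerivAt_posteriorMean [CompleteSpace E] [NeZero μ] {c s : ℝ} (hc : 0 < c)
    (hs : 0 < s) (y a : E)
    (ha : a = (∫ x, gaussianWeight c s y x ∂μ)⁻¹ • ∫ x, gaussianWeight c s y x • x ∂μ) :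
    ∃ L : E →L[ℝ] E,
      HasFDerivAt (fun z ↦ (∫ x, gaussianWeight c s z x ∂μ)⁻¹ •
        ∫ x, gaussianWeight c s z x • x ∂μ) L y ∧
      ∀ u, L u = (s / c) • (∫ x, gaussianWeight c s y x ∂μ)⁻¹ •
        ∫ x, gaussianWeight c s y x • ⟪x - a, u⟫ • (x - a) ∂μ := by
  have one_le (x : E) : ‖(1 : ℝ)‖ ≤ 1 + ‖x‖ := by simp
  have id_le (x : E) : ‖x‖ ≤ 1 + ‖x‖ := by simp
  have hZ := hasFDerivAt_integral_gaussianWeight_smul μ hc hs y continuous_const one_le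
  have hM := hasFDerivAt_integral_gaussianWeight_smul μ hc hs y continuous_id id_le
  have hZi := integrable_fderiv_gaussianWeight_smul μ hc hs y continuous_const one_le
  have hMi := integrable_fderiv_gaussianWeight_smul μ hc hs y continuous_id id_le
  simp only [smul_eq_mul, mul_one, id] at hZ hM hMi
  have hZ0 := (integral_gaussianWeight_pos μ hc hs y).ne'
  refine ⟨_, ((hasDerivAt_inv hZ0).comp_hasFDerivAt y hZ).smul hM, fun u ↦ ?_⟩
  set Z := ∫ x, gaussianWeight c s y x ∂μ with hZdef
  have hMa : ∫ x, gaussianWeight c s y x • x ∂μ = Z • a := by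
    rw [ha, smul_inv_smul₀ hZ0]
  have hZiu := hZi.apply_continuousLinearMap u
  have hMiu := hMi.apply_continuousLinearMap u
  have hwi : Integrable (fun x ↦ gaussianWeight c s y x) μ := by
    by_contra h
    exact hZ0 (integral_undef h)
  have hwx : Integrable (fun x ↦ gaussianWeight c s y x • x) μ :=
    integrable_gaussianWeight_smul μ hc hs y continuous_id 1 fun x ↦ by
      nlinarith [norm_nonneg x]
  have hcent : ∫ x, gaussianWeight c s y x • (x - a) ∂μ = 0 := by
    simp only [smul_sub]
    rw [integral_sub hwx (hwi.smul_const a), integral_smul_const, hMa, sub_self]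
  have key : (∫ x, gaussianWeight c s y x •
        ((-(1 / c)) • innerSL ℝ (y - s • x)).smulRight x ∂μ) u
      - ((∫ x, gaussianWeight c s y x •
        ((-(1 / c)) • innerSL ℝ (y - s • x)).smulRight (1 : ℝ) ∂μ) u) • a
      = (s / c) • ∫ x, gaussianWeight c s y x • ⟪x - a, u⟫ • (x - a) ∂μ := by
    rw [ContinuousLinearMap.integral_apply hZi, ContinuousLinearMap.integral_apply hMi,
      ← integral_smul_const, ← integral_sub hMiu (hZiu.smul_const a), ← integral_smul]
    have hsplit (x : E) : (gaussianWeight c s y x •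
        ((-(1 / c)) • innerSL ℝ (y - s • x)).smulRight x) u
        - ((gaussianWeight c s y x •
          ((-(1 / c)) • innerSL ℝ (y - s • x)).smulRight (1 : ℝ)) u) • a
        = (s / c) • (gaussianWeight c s y x • ⟪x - a, u⟫ • (x - a))
          + (-(1 / c) * ⟪y - s • a, u⟫) • (gaussianWeight c s y x • (x - a)) := by
      simp only [smul_apply, ContinuousLinearMap.smulRight_apply,
        innerSL_apply_apply, smul_eq_mul, mul_one, inner_sub_left, real_inner_smul_left]
      module
    simp only [hsplit]
    rw [integral_add
      ((integrable_gaussianWeight_smul_inner_sub μ hc hs y a u).fun_smul (s / c))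
      (((hwx.sub (hwi.smul_const a)).congr
        (.of_forall fun x ↦ (smul_sub _ x a).symm)).fun_smul (-(1 / c) * ⟪y - s • a, u⟫)),
      integral_smul (-(1 / c) * ⟪y - s • a, u⟫), hcent, smul_zero, add_zero]
  rw [smul_comm, ← key]
  simp only [add_apply, smul_apply,
    ContinuousLinearMap.smulRight_apply, Function.comp_apply, ← hZdef, hMa, smul_eq_mul,
    smul_sub, smul_smul]
  rw [sub_eq_add_neg, ← neg_smul]
  congr 2
  field_simp

lemma inner_integral_gaussianWeight_smul_comm [CompleteSpace E] {c s : ℝ} (hc : 0 < c)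
    (hs : 0 < s) (y a u v : E) :
    ⟪v, ∫ x, gaussianWeight c s y x • ⟪x - a, u⟫ • (x - a) ∂μ⟫
      = ⟪u, ∫ x, gaussianWeight c s y x • ⟪x - a, v⟫ • (x - a) ∂μ⟫ := by
  rw [← integral_inner (integrable_gaussianWeight_smul_inner_sub μ hc hs y a u),
    ← integral_inner (integrable_gaussianWeight_smul_inner_sub μ hc hs y a v)]
  congr with x
  simp only [real_inner_smul_right, real_inner_comm]
  ring

end GaussianWeight

/-- Lemma 1: variance guidance is covariance-rescaled mean guidance:
`ρ·∇_y[g(m(y))] = ρ·(√ᾱ/(1−ᾱ))·Σ(y)·∇g(m(y))`. -/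
theorem stmt_4 (n : ℕ) (hn : 1 ≤ n) (α : ℝ) (hα0 : 0 < α) (hα1 : α < 1)
    (μ : Measure (EuclideanSpace ℝ (Fin n))) [IsProbabilityMeasure μ]
    (φ : EuclideanSpace ℝ (Fin n) → EuclideanSpace ℝ (Fin n) → ℝ)
    (hφ : ∀ y x, φ y x = (2 * Real.pi * (1 - α)) ^ (-(n : ℝ) / 2) *
        Real.exp (-‖y - Real.sqrt α • x‖ ^ 2 / (2 * (1 - α))))
    (p : EuclideanSpace ℝ (Fin n) → ℝ)
    (hp : ∀ y, p y = ∫ x, φ y x ∂μ)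
    (ν : EuclideanSpace ℝ (Fin n) → Measure (EuclideanSpace ℝ (Fin n)))
    (hν : ∀ y, ν y = μ.withDensity fun x => ENNReal.ofReal (φ y x / p y))
    (m : EuclideanSpace ℝ (Fin n) → EuclideanSpace ℝ (Fin n))
    (hm : ∀ y, m y = ∫ x, x ∂(ν y))
    (Sig : EuclideanSpace ℝ (Fin n) → EuclideanSpace ℝ (Fin n) → EuclideanSpace ℝ (Fin n))
    (hSig : ∀ y u, Sig y u = ∫ x, ⟪x - m y, u⟫ • (x - m y) ∂(ν y))
    (g : EuclideanSpace ℝ (Fin n) → ℝ) (y : EuclideanSpace ℝ (Fin n))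
    (hg : DifferentiableAt ℝ g (m y)) :
    DifferentiableAt ℝ (fun z => g (m z)) y ∧
    ∀ ρ : ℝ, ρ • gradient (fun z => g (m z)) y
        = ρ • ((Real.sqrt α / (1 - α)) • Sig y (gradient g (m y))) := by
  have hc : 0 < 1 - α := by linarith
  have hs : 0 < √α := Real.sqrt_pos.2 hα0
  have hC : 0 < (2 * Real.pi * (1 - α)) ^ (-(n : ℝ) / 2) := by positivity
  have hint (z : EuclideanSpace ℝ (Fin n))
      (f : EuclideanSpace ℝ (Fin n) → EuclideanSpace ℝ (Fin n)) :
      ∫ x, f x ∂(ν z) = (∫ x, gaussianWeight (1 - α) √α z x ∂μ)⁻¹ •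
        ∫ x, gaussianWeight (1 - α) √α z x • f x ∂μ := by
    rw [← integral_withDensity_gaussianWeight μ hC z f, hν z, hp z]
    simp only [hφ, gaussianWeight]
  have hmeq : m = fun z ↦ (∫ x, gaussianWeight (1 - α) √α z x ∂μ)⁻¹ •
      ∫ x, gaussianWeight (1 - α) √α z x • x ∂μ := by
    funext z
    rw [hm, hint]
  obtain ⟨L, hL, hLu⟩ := exists_hasFDerivAt_posteriorMean μ hc hs y (m y) (congrFun hmeq y)
  rw [← hmeq] at hL
  have hcomp := hg.hasFDerivAt.comp y hL
  refine ⟨hcomp.differentiableAt, fun ρ ↦ ?_⟩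
  congr 1
  refine ext_inner_left ℝ fun u ↦ ?_
  rw [real_inner_comm, inner_gradient_left]
  calc fderiv ℝ (fun z ↦ g (m z)) y u = fderiv ℝ g (m y) (L u) := by
        rw [show fderiv ℝ (fun z ↦ g (m z)) y = _ from hcomp.fderiv]; rfl
    _ = ⟪gradient g (m y), L u⟫ := inner_gradient_left.symm
    _ = _ := by
        rw [hLu, hSig, hint]
        simp only [real_inner_smul_right]
        rw [inner_integral_gaussianWeight_smul_comm μ hc hs]
end

section
/- (Hessian of a Gaussian-smoothed predictor.) The smoothed function f̃ is twice differentiable on ℝⁿ, and for every x ∈ ℝⁿ its Hessian, as a bilinear form, is given by (∇²f̃(x))(u,v) = (1/γ²) · ∫_{ℝⁿ} f(x + γδ) · ( ⟨δ, u⟩·⟨δ, v⟩ − ⟨u, v⟩ ) · (2π)^{−n/2} e^{−‖δ‖²/2} dδ for all u, v ∈ ℝⁿ. -/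
open MeasureTheory
open scoped RealInnerProductSpace

namespace GaussianSmoothing

variable {E G : Type*} [NormedAddCommGroup E] [InnerProductSpace ℝ E] [NormedAddCommGroup G]
  [NormedSpace ℝ G]

/-- The average of `f (x + γ • δ)` over `δ`, against the vector-valued weight `g`. -/
noncomputable def smoothing [MeasureSpace E] (f : E → ℝ) (γ : ℝ) (g : E → G) (x : E) : G :=
  ∫ δ, f (x + γ • δ) • g δ

/-- The function `g` is bounded by a multiple of `exp (-‖δ‖ ^ 2 / 4)`. -/
def HasGaussianDecay (g : E → G) : Prop :=
  ∃ M, ∀ δ, ‖g δ‖ ≤ M * Real.exp (-‖δ‖ ^ 2 / 4)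

lemma integrable_exp_neg_mul_norm_sq [FiniteDimensional ℝ E] [MeasurableSpace E] [BorelSpace E]
    {b : ℝ} (hb : 0 < b) : Integrable (fun δ : E ↦ Real.exp (-b * ‖δ‖ ^ 2)) := by
  have h := (GaussianFourier.integrable_cexp_neg_mul_sq_norm_add (V := E) (b := (b : ℂ))
    (by simpa using hb) 0 0).norm
  refine h.congr (.of_forall fun δ ↦ ?_)
  simp only [Complex.norm_exp]
  norm_cast
  simp

omit [InnerProductSpace ℝ E] [NormedSpace ℝ G] in
lemma HasGaussianDecay.exists_translate_bound {g : E → G} (hg : HasGaussianDecay g) :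
    ∃ M, 0 ≤ M ∧ ∀ δ h : E, ‖h‖ ≤ 1 → ‖g (δ - h)‖ ≤ M * Real.exp (-(1 / 8) * ‖δ‖ ^ 2) := by
  obtain ⟨M, hM⟩ := hg
  have hM0 : 0 ≤ M := by
    have h := (norm_nonneg _).trans (hM 0)
    simpa using h
  refine ⟨M * Real.exp (1 / 4), by positivity, fun δ h hh ↦ (hM _).trans ?_⟩
  rw [mul_assoc, ← Real.exp_add]
  gcongr
  have h1 : ‖δ‖ ≤ ‖δ - h‖ + ‖h‖ := by simpa using norm_add_le (δ - h) h
  have h2 : ‖δ‖ ≤ ‖δ - h‖ + 1 := by linarith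
  nlinarith [sq_nonneg (‖δ - h‖ - 1), norm_nonneg δ, norm_nonneg (δ - h)]

variable [FiniteDimensional ℝ E] [MeasurableSpace E] [BorelSpace E]

lemma smoothing_eq_translate (f : E → ℝ) {γ : ℝ} (hγ : γ ≠ 0) (g : E → G) (x₀ x : E) :
    smoothing f γ g x = ∫ δ, f (x₀ + γ • δ) • g (δ - γ⁻¹ • (x - x₀)) := by
  rw [smoothing, ← integral_sub_right_eq_self _ (γ⁻¹ • (x - x₀))]
  congr 1 with δ
  congr 2
  rw [smul_sub, smul_inv_smul₀ hγ]
  abel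

variable {f : E → ℝ} {γ C : ℝ} {g : E → G} {g' : E → E →L[ℝ] G}

omit [FiniteDimensional ℝ E] [MeasurableSpace E] [BorelSpace E] in
lemma norm_inv_smul_sub_le_one (hγ : 0 < γ) {x₀ x : E} (hx : x ∈ Metric.ball x₀ γ) :
    ‖γ⁻¹ • (x - x₀)‖ ≤ 1 := by
  rw [norm_smul, norm_inv, Real.norm_of_nonneg hγ.le, inv_mul_le_iff₀ hγ, mul_one]
  exact (mem_ball_iff_norm.mp hx).le

lemma aestronglyMeasurable_smul (hf : Measurable f) (hg : Continuous g) (x h : E) :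
    AEStronglyMeasurable (fun δ ↦ f (x + γ • δ) • g (δ - h)) := by
  refine AEStronglyMeasurable.smul ?_
    (by fun_prop : Continuous fun δ ↦ g (δ - h)).aestronglyMeasurable
  exact (hf.comp (by fun_prop : Continuous fun δ : E ↦ x + γ • δ).measurable).aestronglyMeasurable

omit [InnerProductSpace ℝ E] [FiniteDimensional ℝ E] [MeasurableSpace E] [BorelSpace E] in
lemma norm_smul_le_bound (hC : ∀ x, |f x| ≤ C) {M : ℝ}
    (hM : ∀ δ h : E, ‖h‖ ≤ 1 → ‖g (δ - h)‖ ≤ M * Real.exp (-(1 / 8) * ‖δ‖ ^ 2))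
    (y δ : E) {h : E} (hh : ‖h‖ ≤ 1) :
    ‖f y • g (δ - h)‖ ≤ C * (M * Real.exp (-(1 / 8) * ‖δ‖ ^ 2)) := by
  rw [norm_smul]
  exact mul_le_mul (hC _) (hM δ h hh) (norm_nonneg _) ((abs_nonneg _).trans (hC y))

lemma integrable_bound (C M : ℝ) :
    Integrable (fun δ : E ↦ C * (M * Real.exp (-(1 / 8) * ‖δ‖ ^ 2))) :=
  ((integrable_exp_neg_mul_norm_sq (by norm_num)).const_mul M).const_mul C

lemma integrable_smul (hf : Measurable f) (hC : ∀ x, |f x| ≤ C) (hg : Continuous g)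
    (hd : HasGaussianDecay g) (x : E) : Integrable (fun δ ↦ f (x + γ • δ) • g δ) := by
  obtain ⟨M, -, hM⟩ := hd.exists_translate_bound
  refine (integrable_bound C M).mono' (by simpa using aestronglyMeasurable_smul hf hg x 0)
    (.of_forall fun δ ↦ ?_)
  simpa using norm_smul_le_bound hC hM (x + γ • δ) δ (h := 0) (by simp)

lemma continuous_smoothing (hγ : 0 < γ) (hf : Measurable f) (hC : ∀ x, |f x| ≤ C)
    (hg : Continuous g) (hd : HasGaussianDecay g) : Continuous (smoothing f γ g) := by
  obtain ⟨M, -, hM⟩ := hd.exists_translate_bound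
  refine continuous_iff_continuousAt.mpr fun x₀ ↦ ?_
  rw [funext (smoothing_eq_translate f hγ.ne' g x₀)]
  refine continuousAt_of_dominated (.of_forall fun x ↦ aestronglyMeasurable_smul hf hg _ _) ?_
    (integrable_bound C M) (.of_forall fun δ ↦ by fun_prop)
  filter_upwards [Metric.ball_mem_nhds x₀ hγ] with x hx
  exact .of_forall fun δ ↦ norm_smul_le_bound hC hM _ δ (norm_inv_smul_sub_le_one hγ hx)

lemma hasFDerivAt_smoothing (hγ : 0 < γ) (hf : Measurable f) (hC : ∀ x, |f x| ≤ C)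
    (hd : HasGaussianDecay g) (hg' : Continuous g') (hd' : HasGaussianDecay g')
    (h : ∀ δ, HasFDerivAt g (-g' δ) δ) (x₀ : E) :
    HasFDerivAt (smoothing f γ g) (γ⁻¹ • smoothing f γ g' x₀) x₀ := by
  have hg : Continuous g := continuous_iff_continuousAt.mpr fun δ ↦ (h δ).continuousAt
  obtain ⟨M, -, hM⟩ := hd'.exists_translate_bound
  rw [smoothing, ← integral_smul, funext (smoothing_eq_translate f hγ.ne' g x₀)]
  have key := hasFDerivAt_integral_of_dominated_of_fderiv_le (𝕜 := ℝ) (μ := (volume : Measure E))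
    (F := fun x δ ↦ f (x₀ + γ • δ) • g (δ - γ⁻¹ • (x - x₀)))
    (F' := fun x δ ↦ γ⁻¹ • f (x₀ + γ • δ) • g' (δ - γ⁻¹ • (x - x₀)))
    (bound := fun δ ↦ ‖γ⁻¹‖ * (C * (M * Real.exp (-(1 / 8) * ‖δ‖ ^ 2))))
    (Metric.ball_mem_nhds x₀ hγ) (.of_forall fun x ↦ aestronglyMeasurable_smul hf hg _ _)
    (by simpa using integrable_smul hf hC hg hd x₀)
    ((aestronglyMeasurable_smul hf hg' _ _).const_smul γ⁻¹)
    (.of_forall fun δ x hx ↦ ?_) ((integrable_bound C M).const_mul _)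
    (.of_forall fun δ x hx ↦ ?_)
  · simpa using key
  · rw [norm_smul]
    gcongr
    exact norm_smul_le_bound hC hM _ δ (norm_inv_smul_sub_le_one hγ hx)
  · have h1 : HasFDerivAt (fun x ↦ δ - γ⁻¹ • (x - x₀)) (-(γ⁻¹ • ContinuousLinearMap.id ℝ E)) x :=
      (((hasFDerivAt_id x).sub_const x₀).const_smul γ⁻¹).const_sub δ
    convert! ((h _).comp x h1).const_smul (f (x₀ + γ • δ)) using 1
    ext v
    simp [smul_comm γ⁻¹]

omit [FiniteDimensional ℝ E] [MeasurableSpace E] [BorelSpace E]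

omit [InnerProductSpace ℝ E] [NormedSpace ℝ G] in
lemma hasGaussianDecay_of_norm_le {c : ℝ} (hc : 0 ≤ c)
    (hg : ∀ δ, ‖g δ‖ ≤ c * Real.exp (-‖δ‖ ^ 2 / 2) * (1 + ‖δ‖ ^ 2)) : HasGaussianDecay g := by
  refine ⟨4 * c, fun δ ↦ (hg δ).trans ?_⟩
  have h1 : 1 + ‖δ‖ ^ 2 ≤ 4 * Real.exp (‖δ‖ ^ 2 / 4) := by
    linarith [Real.add_one_le_exp (‖δ‖ ^ 2 / 4)]
  calc c * Real.exp (-‖δ‖ ^ 2 / 2) * (1 + ‖δ‖ ^ 2)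
      ≤ c * Real.exp (-‖δ‖ ^ 2 / 2) * (4 * Real.exp (‖δ‖ ^ 2 / 4)) := by gcongr
    _ = 4 * c * (Real.exp (-‖δ‖ ^ 2 / 2) * Real.exp (‖δ‖ ^ 2 / 4)) := by ring
    _ = 4 * c * Real.exp (-‖δ‖ ^ 2 / 4) := by rw [← Real.exp_add]; ring_nf

variable (E) in
/-- The real inner product as a continuous bilinear map. -/
noncomputable def innerCLM : E →L[ℝ] E →L[ℝ] ℝ := innerSL ℝ

@[simp] lemma innerCLM_apply (u v : E) : innerCLM E u v = ⟪u, v⟫ := rfl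

@[simp] lemma norm_innerCLM_apply (u : E) : ‖innerCLM E u‖ = ‖u‖ := innerSL_apply_norm ℝ u

lemma norm_innerCLM_le : ‖innerCLM E‖ ≤ 1 :=
  ContinuousLinearMap.opNorm_le_bound _ zero_le_one fun u ↦ by simp

/-- The Gaussian weight with normalising constant `c`. -/
noncomputable def weight (c : ℝ) (δ : E) : ℝ := c * Real.exp (-‖δ‖ ^ 2 / 2)

/-- Minus the derivative of `weight c`. -/
noncomputable def weightDeriv (c : ℝ) (δ : E) : E →L[ℝ] ℝ := weight c δ • innerCLM E δ

/-- The second derivative of `weight c`. -/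
noncomputable def weightHessian (c : ℝ) (δ : E) : E →L[ℝ] E →L[ℝ] ℝ :=
  weight c δ • ((innerCLM E δ).smulRight (innerCLM E δ) - innerCLM E)

variable {c : ℝ}

lemma hasFDerivAt_weight (δ : E) : HasFDerivAt (weight c) (-weightDeriv c δ) δ := by
  have h := (((hasFDerivAt_id δ).norm_sq.const_mul (-1 / 2)).exp).const_mul c
  convert! h using 1
  · ext y
    simp [weight]
    ring_nf
    simp
  · ext v
    simp [weightDeriv, weight]
    ring_nf

lemma hasFDerivAt_weightDeriv (δ : E) :
    HasFDerivAt (weightDeriv c) (-weightHessian c δ) δ := by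
  have h := (hasFDerivAt_weight (c := c) δ).smul (innerCLM E).hasFDerivAt
  convert! h using 1
  ext u v
  simp [weightDeriv, weightHessian]
  ring

set_option maxSynthPendingDepth 3 in
lemma continuous_weightHessian : Continuous (weightHessian c : E → _) := by
  unfold weightHessian weight
  have : Continuous fun δ : E ↦ (innerCLM E δ).smulRight (innerCLM E δ) :=
    isBoundedBilinearMap_smulRight.continuous.comp
      ((innerCLM E).continuous.prodMk (innerCLM E).continuous)
  fun_prop

omit [InnerProductSpace ℝ E] in
lemma norm_weight (hc : 0 ≤ c) (δ : E) : ‖weight c δ‖ = c * Real.exp (-‖δ‖ ^ 2 / 2) :=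
  Real.norm_of_nonneg (by unfold weight; positivity)

omit [InnerProductSpace ℝ E] in
lemma hasGaussianDecay_weight (hc : 0 ≤ c) : HasGaussianDecay (weight c : E → ℝ) := by
  refine hasGaussianDecay_of_norm_le hc fun δ ↦ ?_
  rw [norm_weight hc]
  exact le_mul_of_one_le_right (by positivity) (by nlinarith [sq_nonneg ‖δ‖])

lemma hasGaussianDecay_weightDeriv (hc : 0 ≤ c) : HasGaussianDecay (weightDeriv c : E → _) := by
  refine hasGaussianDecay_of_norm_le hc fun δ ↦ ?_
  rw [weightDeriv, norm_smul, norm_weight hc, norm_innerCLM_apply]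
  gcongr
  nlinarith [sq_nonneg (‖δ‖ - 1)]

set_option maxSynthPendingDepth 3 in
lemma hasGaussianDecay_weightHessian (hc : 0 ≤ c) :
    HasGaussianDecay (weightHessian c : E → _) := by
  refine hasGaussianDecay_of_norm_le hc fun δ ↦ ?_
  rw [weightHessian, norm_smul, norm_weight hc]
  gcongr
  refine (norm_sub_le _ _).trans ?_
  rw [ContinuousLinearMap.norm_smulRight_apply, norm_innerCLM_apply]
  linarith [norm_innerCLM_le (E := E), sq ‖δ‖]

end GaussianSmoothing

/-- Hessian of a Gaussian-smoothed predictor: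
`(∇²f̃(x))(u,v) = (1/γ²)·∫ f(x+γδ)·(⟨δ,u⟩⟨δ,v⟩ − ⟨u,v⟩)·(2π)^{−n/2} e^{−‖δ‖²/2} dδ`. -/
theorem stmt_8 (n : ℕ) (hn : 1 ≤ n) (γ : ℝ) (hγ : 0 < γ)
    (f : EuclideanSpace ℝ (Fin n) → ℝ) (hfm : Measurable f) (hfb : ∃ C, ∀ x, |f x| ≤ C)
    (ftil : EuclideanSpace ℝ (Fin n) → ℝ)
    (hftil : ∀ x, ftil x = ∫ δ, f (x + γ • δ) *
        ((2 * Real.pi) ^ (-(n : ℝ) / 2) * Real.exp (-‖δ‖ ^ 2 / 2))) :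
    ContDiff ℝ 2 ftil ∧
    ∀ (x u v : EuclideanSpace ℝ (Fin n)),
      iteratedFDeriv ℝ 2 ftil x ![u, v] =
        (1 / γ ^ 2) * ∫ δ, f (x + γ • δ) * (⟪δ, u⟫ * ⟪δ, v⟫ - ⟪u, v⟫) *
          ((2 * Real.pi) ^ (-(n : ℝ) / 2) * Real.exp (-‖δ‖ ^ 2 / 2)) := by
  open GaussianSmoothing in
  obtain ⟨C, hC⟩ := hfb
  set c : ℝ := (2 * Real.pi) ^ (-(n : ℝ) / 2)
  have hc : 0 ≤ c := by positivity
  have hft : ftil = smoothing f γ (weight c) := funext hftil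
  have hcont : Continuous (weightDeriv c : EuclideanSpace ℝ (Fin n) → _) :=
    continuous_iff_continuousAt.mpr fun δ ↦ (hasFDerivAt_weightDeriv δ).continuousAt
  have h1 (x) : HasFDerivAt ftil (γ⁻¹ • smoothing f γ (weightDeriv c) x) x :=
    hft ▸ hasFDerivAt_smoothing hγ hfm hC (hasGaussianDecay_weight hc) hcont
      (hasGaussianDecay_weightDeriv hc) hasFDerivAt_weight x
  have hf1 : fderiv ℝ ftil = fun x ↦ γ⁻¹ • smoothing f γ (weightDeriv c) x :=
    funext fun x ↦ (h1 x).fderiv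
  have h2 (x) : HasFDerivAt (fderiv ℝ ftil)
      (γ⁻¹ • γ⁻¹ • smoothing f γ (weightHessian c) x) x :=
    hf1 ▸ (hasFDerivAt_smoothing hγ hfm hC (hasGaussianDecay_weightDeriv hc)
      continuous_weightHessian (hasGaussianDecay_weightHessian hc)
      hasFDerivAt_weightDeriv x).const_smul γ⁻¹
  refine ⟨?_, fun x u v ↦ ?_⟩
  · refine (contDiff_succ_iff_fderiv (n := 1)).mpr ⟨fun x ↦ (h1 x).differentiableAt, by simp,
      contDiff_one_iff_fderiv.mpr ⟨fun x ↦ (h2 x).differentiableAt, ?_⟩⟩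
    rw [funext fun x ↦ (h2 x).fderiv]
    have := continuous_smoothing hγ hfm hC continuous_weightHessian
      (hasGaussianDecay_weightHessian hc)
    exact (this.const_smul γ⁻¹).const_smul γ⁻¹
  · have hint := integrable_smul (γ := γ) hfm hC continuous_weightHessian
      (hasGaussianDecay_weightHessian hc) x
    rw [iteratedFDeriv_two_apply, (h2 x).fderiv]
    simp only [Matrix.cons_val_zero, Matrix.cons_val_one, smul_apply,
      smul_eq_mul, smoothing]
    rw [ContinuousLinearMap.integral_apply hint,
      ContinuousLinearMap.integral_apply (hint.apply_continuousLinearMap u), ← mul_assoc]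
    congr 1
    · field_simp
    · congr 1 with δ
      simp [weightHessian, weight]
      ring
end

section
/- (Theorem 1, UGD case: one-step update equivalence for samplers affine in the noise prediction.) Let 0 < ᾱ_t ≤ ᾱ_{t−1} < 1 and α_t := ᾱ_t/ᾱ_{t−1}. Let S : ℝⁿ × ℝⁿ → ℝⁿ be affine in its second argument with linear coefficient δ ∈ ℝ, i.e. S(z, ε + v) = S(z, ε) + δ·v for all z, ε, v ∈ ℝⁿ. Let ℓ̂ : ℝⁿ → ℝ be differentiable at z ∈ ℝⁿ (the composite loss z ↦ ℓ(c, F(ẑ₀(z)))), set f̂ := exp ∘ (−ℓ̂), and let s ∈ ℝ and Δ₀ ∈ ℝⁿ (the backward-guidance correction). Define ρ := −√α_t·s·δ and μ := −√(α_t/(1 − ᾱ_t))·δ. Then ∇(log f̂)(z) = −∇ℓ̂(z), and for every ε ∈ ℝⁿ the UGD update S(z, ε + s·∇ℓ̂(z) − √(ᾱ_t/(1 − ᾱ_t))·Δ₀) equals the TFG update S(z, ε) + (ρ/√α_t)·∇(log f̂)(z) + √ᾱ_{t−1}·μ·Δ₀. -/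
/-- Theorem 1, UGD case: one-step update equivalence for samplers affine in the
noise prediction. -/
theorem stmt_13 (n : ℕ) (hn : 1 ≤ n)
    (abart abartm1 αt : ℝ)
    (h1 : 0 < abart) (h2 : abart ≤ abartm1) (h3 : abartm1 < 1)
    (hαt : αt = abart / abartm1)
    (S : EuclideanSpace ℝ (Fin n) → EuclideanSpace ℝ (Fin n) → EuclideanSpace ℝ (Fin n))
    (δ : ℝ)
    (hS : ∀ z ε v : EuclideanSpace ℝ (Fin n), S z (ε + v) = S z ε + δ • v)
    (ℓ : EuclideanSpace ℝ (Fin n) → ℝ) (z : EuclideanSpace ℝ (Fin n))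
    (hℓ : DifferentiableAt ℝ ℓ z)
    (fhat : EuclideanSpace ℝ (Fin n) → ℝ) (hfhat : fhat = fun w => Real.exp (-(ℓ w)))
    (s : ℝ) (Δ0 : EuclideanSpace ℝ (Fin n))
    (ρ μ : ℝ)
    (hρ : ρ = -(Real.sqrt αt * s * δ))
    (hμ : μ = -(Real.sqrt (αt / (1 - abart)) * δ)) :
    gradient (fun w => Real.log (fhat w)) z = -gradient ℓ z ∧
    ∀ ε : EuclideanSpace ℝ (Fin n),
      S z (ε + (s • gradient ℓ z - Real.sqrt (abart / (1 - abart)) • Δ0))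
        = S z ε + (ρ / Real.sqrt αt) • gradient (fun w => Real.log (fhat w)) z
            + (Real.sqrt abartm1 * μ) • Δ0 := by
  have hgrad : gradient (fun w => Real.log (fhat w)) z = -gradient ℓ z := by
    simp only [hfhat, Real.log_exp]
    simp only [gradient, fderiv_fun_neg, map_neg]
  have hpos : 0 < abartm1 := h1.trans_le h2
  have hα_pos : 0 < αt := hαt ▸ div_pos h1 hpos
  have hvar : ρ / √αt = -(s * δ) := by
    rw [hρ]
    field_simp
  have hmean : √abartm1 * μ = -(√(abart / (1 - abart)) * δ) := by
    have hsqrt : √abartm1 * √(αt / (1 - abart)) = √(abart / (1 - abart)) := by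
      rw [← Real.sqrt_mul hpos.le, hαt, ← mul_div_assoc, mul_div_cancel₀ _ hpos.ne']
    rw [hμ, ← hsqrt]
    ring
  refine ⟨hgrad, fun ε => ?_⟩
  rw [hS, hgrad, hvar, hmean]
  module
end
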